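/- arXiv:1311.5756 — 4 statements merged into one kernel-verified Lean document; each statement's English description precedes it below -/
import Mathlib

section
/- (Corollary 5.3.) Fix 1 < s < ∞. If a weight w belongs to RH_s, then w^s belongs to A_∞. -/
open MeasureTheory

/-- The collection of open balls `B(x, ρ)` (with `ρ > 0`) such that the doubled ball
`B(x, 2ρ)` is contained in `Ω`. -/
def ballsIn {n : ℕ} (Ω : Set (EuclideanSpace ℝ (Fin n))) :
    Set (Set (EuclideanSpace ℝ (Fin n))) :=
  {B | ∃ x ρ, 0 < ρ ∧ B = Metric.ball x ρ ∧ Metric.ball x (2 * ρ) ⊆ Ω}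

/-- A weight on `Ω`: a measurable function that is positive a.e. on `Ω`. -/
def IsWeight {n : ℕ} (Ω : Set (EuclideanSpace ℝ (Fin n)))
    (w : EuclideanSpace ℝ (Fin n) → ℝ) : Prop :=
  Measurable w ∧ ∀ᵐ x ∂volume, x ∈ Ω → 0 < w x

/-- The `p`-mean of `w` over `B`, for an extended-real exponent `p`. -/
noncomputable def pMean {n : ℕ} (w : EuclideanSpace ℝ (Fin n) → ℝ) (p : EReal)
    (B : Set (EuclideanSpace ℝ (Fin n))) : ℝ :=
  if p = ⊤ then essSup w (volume.restrict B)
  else if p = ⊥ then essInf w (volume.restrict B)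
  else if p = 0 then Real.exp (⨍ x in B, Real.log (w x))
  else (⨍ x in B, (w x) ^ p.toReal) ^ (1 / p.toReal)

open Classical in
/-- Finiteness of the `p`-mean of `w` over `B`. -/
def MeanFinite {n : ℕ} (w : EuclideanSpace ℝ (Fin n) → ℝ) (p : EReal)
    (B : Set (EuclideanSpace ℝ (Fin n))) : Prop :=
  if p = ⊤ then ∃ M : ℝ, ∀ᵐ x ∂(volume.restrict B), w x ≤ M
  else if p = ⊥ then ∃ m : ℝ, ∀ᵐ x ∂(volume.restrict B), m ≤ w x
  else if p = 0 then IntegrableOn (fun x => Real.log (w x)) B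
  else IntegrableOn (fun x => (w x) ^ p.toReal) B

/-- `w ∈ RC(r, s, C)` over `Ω`: for every admissible ball the `r`- and `s`-means are finite
and `w(s,B) ≤ C · w(r,B)`. -/
def MemRC {n : ℕ} (Ω : Set (EuclideanSpace ℝ (Fin n)))
    (w : EuclideanSpace ℝ (Fin n) → ℝ) (r s : EReal) (C : ℝ) : Prop :=
  ∀ B ∈ ballsIn Ω, MeanFinite w r B ∧ MeanFinite w s B ∧ pMean w s B ≤ C * pMean w r B

/-- `w ∈ RC(r,s) = ⋃_{C ≥ 1} RC(r,s,C)`. -/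
def InRC {n : ℕ} (Ω : Set (EuclideanSpace ℝ (Fin n)))
    (w : EuclideanSpace ℝ (Fin n) → ℝ) (r s : EReal) : Prop :=
  ∃ C : ℝ, 1 ≤ C ∧ MemRC Ω w r s C

/-- `[w]_{RC(r,s)}`, the least admissible reversal constant. -/
noncomputable def RCconst {n : ℕ} (Ω : Set (EuclideanSpace ℝ (Fin n)))
    (w : EuclideanSpace ℝ (Fin n) → ℝ) (r s : EReal) : ℝ :=
  sInf {C : ℝ | 1 ≤ C ∧ MemRC Ω w r s C}


section Aux

open Set Filter Topology

lemma aux_vol {n : ℕ} (y : EuclideanSpace ℝ (Fin n)) {r : ℝ} (hr : 0 < r) :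
    volume.real (Metric.ball y r) = r ^ n * volume.real (Metric.ball (0 : EuclideanSpace ℝ (Fin n)) 1) := by
  rw [measureReal_def, Measure.addHaar_ball_of_pos _ _ hr, ENNReal.toReal_mul,
    ENNReal.toReal_ofReal (by positivity), finrank_euclideanSpace_fin]
  rfl

lemma aux_v1 {n : ℕ} : 0 < volume.real (Metric.ball (0 : EuclideanSpace ℝ (Fin n)) 1) := by
  rw [measureReal_def]
  exact ENNReal.toReal_pos (Metric.measure_ball_pos _ _ one_pos).ne' measure_ball_lt_top.ne

lemma aux_cb {n : ℕ} (y : EuclideanSpace ℝ (Fin n)) {r : ℝ} (hr : 0 < r) :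
    (Metric.closedBall y r : Set _) =ᵐ[volume] Metric.ball y r := by
  have h0 := Measure.addHaar_sphere_of_ne_zero (volume : Measure (EuclideanSpace ℝ (Fin n))) y hr.ne'
  rw [← Metric.ball_union_sphere]
  exact union_ae_eq_left_of_ae_eq_empty (ae_eq_empty.2 h0)

/-- center of the shrunken ball -/
noncomputable def cen {n : ℕ} (x0 x : EuclideanSpace ℝ (Fin n)) (t : ℝ) : EuclideanSpace ℝ (Fin n) :=
  x + t • (x0 - x)

lemma cen_dist {n : ℕ} (x0 x : EuclideanSpace ℝ (Fin n)) (s t : ℝ) :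
    dist (cen x0 x s) (cen x0 x t) = |s - t| * dist x0 x := by
  rw [dist_eq_norm, dist_eq_norm, cen, cen, add_sub_add_left_eq_sub, ← sub_smul, norm_smul,
    Real.norm_eq_abs]

lemma cen_one {n : ℕ} (x0 x : EuclideanSpace ℝ (Fin n)) : cen x0 x 1 = x0 := by simp [cen]
lemma cen_zero {n : ℕ} (x0 x : EuclideanSpace ℝ (Fin n)) : cen x0 x 0 = x := by simp [cen]

lemma cen_mono {n : ℕ} {x0 x : EuclideanSpace ℝ (Fin n)} {ρ : ℝ} (hx : dist x0 x ≤ ρ)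
    {s t : ℝ} (hst : s ≤ t) :
    Metric.ball (cen x0 x s) (s * ρ) ⊆ Metric.ball (cen x0 x t) (t * ρ) := by
  apply Metric.ball_subset_ball'
  rw [cen_dist, abs_sub_comm, abs_of_nonneg (sub_nonneg.2 hst)]
  nlinarith [mul_le_mul_of_nonneg_left hx (sub_nonneg.2 hst)]

lemma crossing {n : ℕ} {x0 x : EuclideanSpace ℝ (Fin n)} {ρ : ℝ} (hρ : 0 < ρ)
    (hx : dist x0 x ≤ ρ) {S : Set (EuclideanSpace ℝ (Fin n))} (hS : MeasurableSet S)
    {α : ℝ} (hα : 0 < α) (hα1 : α < 1)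
    (h1 : α * volume.real (Metric.ball x0 ρ) ≤ volume.real (Metric.ball x0 ρ \ S))
    (hd : Tendsto (fun t : ℝ => volume (S ∩ Metric.closedBall (cen x0 x t) (t * ρ)) /
      volume (Metric.closedBall (cen x0 x t) (t * ρ))) (𝓝[>] 0) (𝓝 1)) :
    ∃ t, 0 < t ∧ t ≤ 1 ∧ volume.real (Metric.ball (cen x0 x t) (t * ρ) \ S) =
      α * volume.real (Metric.ball (cen x0 x t) (t * ρ)) := by
  have hlt : ENNReal.ofReal (1 - α) < 1 := by
    rw [ENNReal.ofReal_lt_one]; linarith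
  obtain ⟨t0, ht0, ht0pos, ht01⟩ : ∃ t : ℝ, ENNReal.ofReal (1 - α) <
      volume (S ∩ Metric.closedBall (cen x0 x t) (t * ρ)) /
      volume (Metric.closedBall (cen x0 x t) (t * ρ)) ∧ 0 < t ∧ t < 1 := by
    have h2 : ∀ᶠ t : ℝ in 𝓝[>] 0, 0 < t ∧ t < 1 := Ioo_mem_nhdsGT one_pos
    exact ((hd.eventually (lt_mem_nhds hlt)).and h2).exists
  set v := volume.real (Metric.ball x0 ρ) with hv
  have hvpos : 0 < v := by rw [hv, aux_vol _ hρ]; have := @aux_v1 n; positivity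
  have hvt : ∀ t, 0 < t → volume.real (Metric.ball (cen x0 x t) (t * ρ)) = t ^ n * v := by
    intro t ht
    rw [hv, aux_vol _ hρ, aux_vol _ (by positivity)]; ring
  set g : ℝ → ℝ := fun t => volume.real (Metric.ball (cen x0 x t) (t * ρ) \ S) with hg
  have hgd : ∀ s t, 0 < s → s ≤ t → g s ≤ g t ∧ g t - g s ≤ t ^ n * v - s ^ n * v := by
    intro s t hs hst
    have hsub := cen_mono hx hst
    refine ⟨measureReal_mono (sdiff_subset_sdiff_left hsub) (measure_ne_top_of_subset sdiff_subset measure_ball_lt_top.ne), ?_⟩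
    rw [← hvt s hs, ← hvt t (hs.trans_le hst), ← measureReal_sdiff hsub measurableSet_ball measure_ball_lt_top.ne]
    have : g t ≤ volume.real ((Metric.ball (cen x0 x s) (s * ρ) \ S) ∪
      (Metric.ball (cen x0 x t) (t * ρ) \ Metric.ball (cen x0 x s) (s * ρ))) := by
      apply measureReal_mono
      · intro z hz
        by_cases hzs : z ∈ Metric.ball (cen x0 x s) (s * ρ)
        · exact Or.inl ⟨hzs, hz.2⟩
        · exact Or.inr ⟨hz.1, hzs⟩
      · refine measure_union_ne_top (measure_ne_top_of_subset sdiff_subset measure_ball_lt_top.ne) (measure_ne_top_of_subset sdiff_subset measure_ball_lt_top.ne)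
    have h3 := this.trans (measureReal_union_le _ _)
    linarith
  have hcont : ContinuousOn g (Icc t0 1) := by
    intro t ht
    have htp : 0 < t := ht0pos.trans_le ht.1
    have hb : ∀ s ∈ Icc t0 1, dist (g s) (g t) ≤ |s ^ n * v - t ^ n * v| := by
      intro s hs
      have hsp : 0 < s := ht0pos.trans_le hs.1
      rw [Real.dist_eq]
      rcases le_total s t with h | h
      · have := hgd s t hsp h
        rw [abs_sub_comm, abs_of_nonneg (by linarith), abs_sub_comm (s ^ n * v)]
        exact this.2.trans (le_abs_self _)
      · have := hgd t s htp h
        rw [abs_of_nonneg (by linarith)]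
        exact this.2.trans (le_abs_self _)
    rw [ContinuousWithinAt, tendsto_iff_dist_tendsto_zero]
    refine squeeze_zero' (Eventually.of_forall fun _ => dist_nonneg)
      (eventually_of_mem self_mem_nhdsWithin hb) ?_
    have : Continuous fun s : ℝ => |s ^ n * v - t ^ n * v| := by fun_prop
    have h4 := this.tendsto t
    simp only [sub_self, abs_zero] at h4
    exact h4.mono_left nhdsWithin_le_nhds
  have hcont2 : ContinuousOn (fun t => g t - α * (t ^ n * v)) (Icc t0 1) :=
    hcont.sub (by fun_prop)
  have hA : g t0 - α * (t0 ^ n * v) ≤ 0 := by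
    have hr : 0 < t0 * ρ := by positivity
    have e1 : volume (Metric.closedBall (cen x0 x t0) (t0 * ρ)) = volume (Metric.ball (cen x0 x t0) (t0 * ρ)) :=
      measure_congr (aux_cb _ hr)
    have e2 : volume (S ∩ Metric.closedBall (cen x0 x t0) (t0 * ρ)) = volume (S ∩ Metric.ball (cen x0 x t0) (t0 * ρ)) :=
      measure_congr ((ae_eq_refl S).inter (aux_cb _ hr))
    rw [e1, e2] at ht0
    have hfin : volume (S ∩ Metric.ball (cen x0 x t0) (t0 * ρ)) ≠ ⊤ :=
      measure_ne_top_of_subset inter_subset_right measure_ball_lt_top.ne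
    have h5 := ENNReal.mul_le_of_le_div ht0.le
    have h6 := ENNReal.toReal_mono hfin h5
    rw [ENNReal.toReal_mul, ENNReal.toReal_ofReal (by linarith), ← measureReal_def, ← measureReal_def, inter_comm] at h6
    have h7 := measureReal_inter_add_sdiff (μ := volume) (s := Metric.ball (cen x0 x t0) (t0 * ρ)) hS measure_ball_lt_top.ne
    rw [hvt t0 ht0pos] at h6 h7
    simp only [hg]
    linarith
  have hB : 0 ≤ g 1 - α * (1 ^ n * v) := by
    simp only [hg, cen_one, one_mul, one_pow]
    linarith
  obtain ⟨t, ht, hte⟩ := intermediate_value_Icc ht01.le hcont2 ⟨hA, hB⟩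
  have htp : 0 < t := ht0pos.trans_le ht.1
  refine ⟨t, htp, ht.2, ?_⟩
  rw [hvt t htp]
  simp only at hte
  linarith

lemma subavg {n : ℕ} {w : EuclideanSpace ℝ (Fin n) → ℝ} (hwm : Measurable w)
    {x0 : EuclideanSpace ℝ (Fin n)} {ρ : ℝ} (hint : IntegrableOn w (Metric.ball x0 ρ))
    {α : ℝ}
    (H : ∀ y r, 0 < r → Metric.ball y r ⊆ Metric.ball x0 ρ → dist y x0 + r ≤ ρ →
      ∀ F ⊆ Metric.ball y r, MeasurableSet F →
      volume.real F ≤ α * volume.real (Metric.ball y r) →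
      ∫ x in F, w x ≤ 1 / 2 * ∫ x in Metric.ball y r, w x)
    {m : ℝ} (hm : 0 < m) {y : EuclideanSpace ℝ (Fin n)} {r : ℝ} (hr : 0 < r)
    (hyr : dist y x0 + r ≤ ρ)
    (hle : volume.real (Metric.ball y r \ (Metric.ball x0 ρ ∩ {x | w x < m})) ≤
      α * volume.real (Metric.ball y r)) :
    ∫ x in Metric.ball y r, w x ≤ 2 * m * volume.real (Metric.ball y r) := by
  have hsub : Metric.ball y r ⊆ Metric.ball x0 ρ := Metric.ball_subset_ball' (by linarith)
  have hS : MeasurableSet (Metric.ball x0 ρ ∩ {x | w x < m}) :=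
    measurableSet_ball.inter (measurableSet_lt hwm measurable_const)
  set S := Metric.ball x0 ρ ∩ {x | w x < m}
  have h1 := H y r hr hsub hyr _ sdiff_subset (measurableSet_ball.diff hS) hle
  have hi : IntegrableOn w (Metric.ball y r) := hint.mono_set hsub
  have h2 := integral_inter_add_sdiff hS hi
  have h3 : ∫ x in Metric.ball y r ∩ S, w x ≤ ∫ x in Metric.ball y r ∩ S, m := by
    refine setIntegral_mono_on (hi.mono_set inter_subset_left) ?_ (measurableSet_ball.inter hS) ?_
    · exact integrableOn_const (measure_ne_top_of_subset inter_subset_left measure_ball_lt_top.ne)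
    · intro x hx
      exact le_of_lt hx.2.2
  rw [setIntegral_const, smul_eq_mul] at h3
  have h4 : volume.real (Metric.ball y r ∩ S) ≤ volume.real (Metric.ball y r) :=
    measureReal_mono inter_subset_left measure_ball_lt_top.ne
  nlinarith [mul_le_mul_of_nonneg_right h4 hm.le]

lemma step {n : ℕ} {w : EuclideanSpace ℝ (Fin n) → ℝ} (hwm : Measurable w)
    {x0 : EuclideanSpace ℝ (Fin n)} {ρ : ℝ} (hρ : 0 < ρ)
    (hint : IntegrableOn w (Metric.ball x0 ρ))
    (hpos : ∀ᵐ x ∂(volume.restrict (Metric.ball x0 ρ)), 0 < w x)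
    {α : ℝ} (hα : 0 < α) (hα1 : α < 1)
    (H : ∀ y r, 0 < r → Metric.ball y r ⊆ Metric.ball x0 ρ → dist y x0 + r ≤ ρ →
      ∀ F ⊆ Metric.ball y r, MeasurableSet F →
      volume.real F ≤ α * volume.real (Metric.ball y r) →
      ∫ x in F, w x ≤ 1 / 2 * ∫ x in Metric.ball y r, w x)
    {l : ℝ} (hl : 0 < l)
    (hl2 : 2 * (α / 4 * l) * volume.real (Metric.ball x0 ρ) < ∫ x in Metric.ball x0 ρ, w x) :
    volume (Metric.ball x0 ρ ∩ {x | w x < α / 4 * l}) ≤ ENNReal.ofReal (5 ^ n * (2 / α)) *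
      volume (Metric.ball x0 ρ ∩ {x | α / 4 * l ≤ w x ∧ w x < l}) := by
  set m := α / 4 * l with hm
  have hmpos : 0 < m := by positivity
  set B := Metric.ball x0 ρ with hB
  set S := B ∩ {x | w x < m} with hSd
  set G := B ∩ {x | m ≤ w x ∧ w x < l} with hGd
  have hS : MeasurableSet S := measurableSet_ball.inter (measurableSet_lt hwm measurable_const)
  have hG : MeasurableSet G := measurableSet_ball.inter
    ((measurableSet_le measurable_const hwm).inter (measurableSet_lt hwm measurable_const))
  have h1 : α * volume.real B ≤ volume.real (B \ S) := by
    by_contra! hcon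
    have := subavg hwm hint H hmpos hρ (by simp) hcon.le
    linarith
  have hdens := IsUnifLocDoublingMeasure.ae_tendsto_measure_inter_div
    (volume : Measure (EuclideanSpace ℝ (Fin n))) S 1
  have hex : ∀ᵐ x ∂volume, x ∈ S → ∃ t, 0 < t ∧ t ≤ 1 ∧
      volume.real (Metric.ball (cen x0 x t) (t * ρ) \ S) =
      α * volume.real (Metric.ball (cen x0 x t) (t * ρ)) := by
    rw [ae_restrict_iff' hS] at hdens
    filter_upwards [hdens] with x hx hxS
    have hxd : dist x0 x ≤ ρ := by
      have := hxS.1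
      rw [hB, Metric.mem_ball, dist_comm] at this
      exact this.le
    refine crossing hρ hxd hS hα hα1 h1 (hx hxS (fun t => cen x0 x t) (fun t => t * ρ) ?_ ?_)
    · rw [tendsto_nhdsWithin_iff]
      constructor
      · have : Continuous fun t : ℝ => t * ρ := by fun_prop
        have h := this.tendsto 0
        simp only [zero_mul] at h
        exact h.mono_left nhdsWithin_le_nhds
      · filter_upwards [self_mem_nhdsWithin] with t ht
        exact mul_pos ht hρ
    · filter_upwards [self_mem_nhdsWithin] with t ht
      have ht : 0 < t := ht
      have := cen_dist x0 x 0 t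
      rw [cen_zero] at this
      rw [Metric.mem_closedBall, this, zero_sub, abs_neg, abs_of_pos ht, one_mul]
      gcongr
  set T := {x | x ∈ S ∧ ∃ t, 0 < t ∧ t ≤ 1 ∧
      volume.real (Metric.ball (cen x0 x t) (t * ρ) \ S) =
      α * volume.real (Metric.ball (cen x0 x t) (t * ρ))} with hT
  have hST : volume S ≤ volume T := by
    apply measure_mono_ae
    filter_upwards [hex] with x hx hxS
    exact ⟨hxS, hx hxS⟩
  have hch : ∀ x, ∃ t, x ∈ T → 0 < t ∧ t ≤ 1 ∧
      volume.real (Metric.ball (cen x0 x t) (t * ρ) \ S) =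
      α * volume.real (Metric.ball (cen x0 x t) (t * ρ)) := by
    intro x
    by_cases hx : x ∈ T
    · obtain ⟨t, ht⟩ := hx.2
      exact ⟨t, fun _ => ht⟩
    · exact ⟨0, fun h => absurd h hx⟩
  choose t ht using hch
  obtain ⟨u, huT, hdisj, hcov⟩ := Vitali.exists_disjoint_subfamily_covering_enlargement_closedBall
    T (fun x => cen x0 x (t x)) (fun x => t x * ρ) ρ
    (fun x hx => by nlinarith [(ht x hx).2.1]) 5 (by norm_num)
  have hdist : ∀ x ∈ T, dist x0 x ≤ ρ := by
    intro x hx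
    have := hx.1.1
    rw [hB, Metric.mem_ball, dist_comm] at this
    exact this.le
  have hrpos : ∀ x ∈ T, 0 < t x * ρ := fun x hx => mul_pos (ht x hx).1 hρ
  have hucount : u.Countable := by
    apply hdisj.countable_of_nonempty_interior
    intro x hx
    exact ⟨cen x0 x (t x), Metric.ball_subset_interior_closedBall (Metric.mem_ball_self (hrpos x (huT hx)))⟩
  have hcov2 : T ⊆ ⋃ x ∈ u, Metric.closedBall (cen x0 x (t x)) (5 * (t x * ρ)) := by
    intro x hx
    obtain ⟨b, hb, hsub⟩ := hcov x hx
    refine mem_biUnion hb (hsub ?_)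
    have := cen_dist x0 x 0 (t x)
    rw [cen_zero] at this
    rw [Metric.mem_closedBall, this, zero_sub, abs_neg, abs_of_pos (ht x hx).1]
    have := hdist x hx
    have := (ht x hx).1
    gcongr
  have hkey : ∀ x ∈ u, volume (Metric.closedBall (cen x0 x (t x)) (5 * (t x * ρ))) ≤
      ENNReal.ofReal (5 ^ n * (2 / α)) * volume (G ∩ Metric.ball (cen x0 x (t x)) (t x * ρ)) := by
    intro x hxu
    have hx := huT hxu
    obtain ⟨htp, ht1, hteq⟩ := ht x hx
    have hr := hrpos x hx
    set y := cen x0 x (t x)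
    set r := t x * ρ with hrd
    have hyr : dist y x0 + r ≤ ρ := by
      have h := cen_dist x0 x (t x) 1
      rw [cen_one, abs_sub_comm, abs_of_nonneg (by linarith)] at h
      have := hdist x hx
      have h2 : (1 - t x) * dist x0 x ≤ (1 - t x) * ρ := by gcongr
      have h3 : dist y x0 = (1 - t x) * dist x0 x := h
      rw [h3, hrd]; linarith
    have hsub : Metric.ball y r ⊆ B := Metric.ball_subset_ball' (by linarith)
    have hav := subavg hwm hint H hmpos hr hyr hteq.le
    have hmark : l * volume.real (Metric.ball y r ∩ {x | l ≤ w x}) ≤ ∫ x in Metric.ball y r, w x := by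
      have := mul_meas_ge_le_integral_of_nonneg (μ := volume.restrict (Metric.ball y r)) (f := w)
        ((ae_restrict_of_ae_restrict_of_subset hsub hpos).mono fun x hx => hx.le)
        (hint.mono_set hsub) l
      rwa [measureReal_restrict_apply (measurableSet_le measurable_const hwm), inter_comm] at this
    have hsplit : volume.real (Metric.ball y r \ S) ≤
        volume.real (Metric.ball y r ∩ {x | l ≤ w x}) + volume.real (G ∩ Metric.ball y r) := by
      refine le_trans (measureReal_mono ?_ ?_) (measureReal_union_le _ _)
      · intro z hz
        have hzB := hsub hz.1
        by_cases hzl : l ≤ w z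
        · exact Or.inl ⟨hz.1, hzl⟩
        · refine Or.inr ⟨⟨hzB, ?_, not_le.1 hzl⟩, hz.1⟩
          by_contra! hcon
          exact hz.2 ⟨hzB, hcon⟩
      · exact measure_union_ne_top (measure_ne_top_of_subset inter_subset_left measure_ball_lt_top.ne)
          (measure_ne_top_of_subset inter_subset_right measure_ball_lt_top.ne)
    have hgood : volume.real (Metric.ball y r) ≤ 2 / α * volume.real (G ∩ Metric.ball y r) := by
      have h5 : volume.real (Metric.ball y r ∩ {x | l ≤ w x}) ≤ α / 2 * volume.real (Metric.ball y r) := by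
        have : l * volume.real (Metric.ball y r ∩ {x | l ≤ w x}) ≤
            l * (α / 2 * volume.real (Metric.ball y r)) := by
          refine (hmark.trans hav).trans (le_of_eq ?_)
          rw [hm]; ring
        exact le_of_mul_le_mul_left this hl
      have h6 : α / 2 * volume.real (Metric.ball y r) ≤ volume.real (G ∩ Metric.ball y r) := by
        linarith
      rw [div_mul_eq_mul_div, le_div_iff₀ hα]
      linarith
    have hf : volume (G ∩ Metric.ball y r) ≠ ⊤ :=
      measure_ne_top_of_subset inter_subset_right measure_ball_lt_top.ne
    have hf2 : volume (Metric.closedBall y (5 * r)) ≠ ⊤ := measure_closedBall_lt_top.ne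
    rw [← ENNReal.ofReal_toReal hf, ← ENNReal.ofReal_toReal hf2, ← ENNReal.ofReal_mul (by positivity)]
    apply ENNReal.ofReal_le_ofReal
    have e1 : (volume (Metric.closedBall y (5 * r))).toReal = 5 ^ n * volume.real (Metric.ball y r) := by
      rw [measure_congr (aux_cb y (by positivity : 0 < 5 * r)), ← measureReal_def,
        aux_vol _ (by positivity), aux_vol _ hr]
      ring
    rw [e1, ← measureReal_def, mul_assoc]
    gcongr
  calc volume S ≤ volume T := hST
    _ ≤ volume (⋃ x ∈ u, Metric.closedBall (cen x0 x (t x)) (5 * (t x * ρ))) := measure_mono hcov2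
    _ ≤ ∑' x : u, volume (Metric.closedBall (cen x0 x.1 (t x.1)) (5 * (t x.1 * ρ))) :=
      measure_biUnion_le volume hucount _
    _ ≤ ∑' x : u, ENNReal.ofReal (5 ^ n * (2 / α)) *
        volume (G ∩ Metric.ball (cen x0 x.1 (t x.1)) (t x.1 * ρ)) :=
      ENNReal.tsum_le_tsum fun x => hkey x.1 x.2
    _ = ENNReal.ofReal (5 ^ n * (2 / α)) *
        volume (⋃ x ∈ u, G ∩ Metric.ball (cen x0 x (t x)) (t x * ρ)) := by
      rw [ENNReal.tsum_mul_left, measure_biUnion hucount]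
      · exact hdisj.mono fun x => inter_subset_right.trans Metric.ball_subset_closedBall
      · intro x _
        exact hG.inter measurableSet_ball
    _ ≤ _ := by
      gcongr
      exact iUnion₂_subset fun x _ => inter_subset_left

lemma young {X : Type*} [MeasurableSpace X] {μ : Measure X} {s C : ℝ} (hs : 1 < s) (hC : 1 ≤ C) :
    ∃ α : ℝ, 0 < α ∧ α < 1 ∧ ∀ (w : X → ℝ) (B F : Set X), MeasurableSet B → MeasurableSet F →
      μ B ≠ ⊤ → F ⊆ B →
      (∀ᵐ x ∂(μ.restrict B), 0 < w x) → IntegrableOn w B μ → IntegrableOn (fun x => w x ^ s) B μ →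
      0 < ∫ x in B, w x ∂μ → 0 < μ.real B →
      ∫ x in B, w x ^ s ∂μ ≤ C ^ s * ((∫ x in B, w x ∂μ) / μ.real B) ^ s * μ.real B →
      μ.real F ≤ α * μ.real B →
      ∫ x in F, w x ∂μ ≤ 1 / 2 * ∫ x in B, w x ∂μ := by
  have hC0 : 0 < C := by linarith
  set M : ℝ := (4 * C ^ s) ^ (1 / (s - 1)) with hM
  have hCs : 1 ≤ C ^ s := Real.one_le_rpow hC (by linarith)
  have hM1 : 1 ≤ M := Real.one_le_rpow (by linarith) (by apply div_nonneg <;> linarith)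
  have hM0 : 0 < M := by linarith
  have hMs : M ^ (1 - s) * C ^ s = 1 / 4 := by
    rw [hM, ← Real.rpow_mul (by positivity)]
    have : 1 / (s - 1) * (1 - s) = -1 := by
      have : s - 1 ≠ 0 := by linarith
      field_simp
      ring
    rw [this, Real.rpow_neg_one]
    field_simp
  refine ⟨1 / (4 * M), by positivity, by rw [div_lt_one (by positivity)]; linarith, ?_⟩
  intro w B F hB hF hBt hFB hpos hi his hI hBp hRH hFs
  set I := ∫ x in B, w x ∂μ
  set b := μ.real B
  set T := M * (I / b) with hT
  have hT0 : 0 < T := by positivity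
  have hpt : ∀ᵐ x ∂(μ.restrict F), w x ≤ T + T ^ (1 - s) * w x ^ s := by
    filter_upwards [ae_restrict_of_ae_restrict_of_subset hFB hpos] with x hx
    rcases le_total (w x) T with h | h
    · have : 0 ≤ T ^ (1 - s) * w x ^ s := by positivity
      linarith
    · have h1 : w x ^ (1 - s) ≤ T ^ (1 - s) := Real.rpow_le_rpow_of_nonpos hT0 h (by linarith)
      have h2 : w x = w x ^ (1 - s) * w x ^ s := by
        rw [← Real.rpow_add hx]; simp
      have h3 : w x ^ (1 - s) * w x ^ s ≤ T ^ (1 - s) * w x ^ s := by gcongr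
      linarith
  have hFt : μ F ≠ ⊤ := measure_ne_top_of_subset hFB hBt
  have h1 : ∫ x in F, w x ∂μ ≤ ∫ x in F, (T + T ^ (1 - s) * w x ^ s) ∂μ :=
    integral_mono_ae (hi.mono_set hFB)
      ((integrableOn_const hFt).add ((his.mono_set hFB).const_mul _)) hpt
  rw [integral_add (integrable_const_iff.2 (Or.inr ⟨by simpa using hFt.lt_top⟩)) ((his.mono_set hFB).const_mul _), setIntegral_const,
    integral_const_mul, smul_eq_mul] at h1
  have h2 : ∫ x in F, w x ^ s ∂μ ≤ ∫ x in B, w x ^ s ∂μ := by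
    apply setIntegral_mono_set his
    · filter_upwards [hpos] with x hx
      simp only [Pi.zero_apply]
      positivity
    · exact hFB.eventuallyLE
  have h3 : T ^ (1 - s) * ∫ x in F, w x ^ s ∂μ ≤ 1 / 4 * I := by
    calc T ^ (1 - s) * ∫ x in F, w x ^ s ∂μ ≤ T ^ (1 - s) * (C ^ s * (I / b) ^ s * b) := by
          gcongr; exact h2.trans hRH
      _ = (M ^ (1 - s) * C ^ s) * ((I / b) ^ (1 - s) * (I / b) ^ s) * b := by
          rw [hT, Real.mul_rpow hM0.le (by positivity)]; ring
      _ = 1 / 4 * I := by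
          rw [hMs, ← Real.rpow_add (by positivity)]
          simp
          field_simp
  have h4 : μ.real F * T ≤ 1 / 4 * I := by
    calc μ.real F * T ≤ 1 / (4 * M) * b * T := by gcongr
      _ = 1 / 4 * I := by rw [hT]; field_simp
  linarith

lemma logbound {X : Type*} [MeasurableSpace X] {ν : Measure X} [IsFiniteMeasure ν]
    {w : X → ℝ} (hwm : Measurable w) (hpos : ∀ᵐ x ∂ν, 0 < w x) {a κ θ : ℝ} (ha : 0 < a)
    (hκ : 0 < κ) (hκ1 : κ < 1) (hθ : 0 ≤ θ) (hθ1 : θ < 1)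
    (hdec : ∀ k : ℕ, ν.real {x | w x < κ ^ k * a} ≤ θ ^ k * ν.real univ) :
    Integrable (fun x => max 0 (Real.log (a / w x))) ν ∧
    ∫ x, max 0 (Real.log (a / w x)) ∂ν ≤ Real.log (1 / κ) / (1 - θ) * ν.real univ := by
  set L := Real.log (1 / κ) with hL
  have hL0 : 0 < L := Real.log_pos (by rw [lt_div_iff₀ hκ]; linarith)
  have hmeas : Measurable (fun x => max 0 (Real.log (a / w x))) := by fun_prop
  have hEm : ∀ k : ℕ, MeasurableSet {x | w x < κ ^ k * a} := fun k =>
    measurableSet_lt hwm measurable_const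
  have hpt : ∀ᵐ x ∂ν, ENNReal.ofReal (max 0 (Real.log (a / w x))) ≤
      ∑' k : ℕ, ({x | w x < κ ^ k * a} : Set X).indicator (fun _ => ENNReal.ofReal L) x := by
    filter_upwards [hpos] with x hx
    set N := ⌈Real.log (a / w x) / L⌉₊ with hN
    have h1 : ∀ k ∈ Finset.range N, ({x | w x < κ ^ k * a} : Set X).indicator
        (fun _ => ENNReal.ofReal L) x = ENNReal.ofReal L := by
      intro k hk
      apply indicator_of_mem
      have hk : (k : ℝ) < Real.log (a / w x) / L := Nat.lt_ceil.1 (Finset.mem_range.1 hk)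
      rw [lt_div_iff₀ hL0, hL, one_div, Real.log_inv, Real.log_div ha.ne' hx.ne'] at hk
      show w x < κ ^ k * a
      rw [← Real.log_lt_log_iff hx (by positivity), Real.log_mul (by positivity) ha.ne',
        Real.log_pow]
      linarith
    refine le_trans ?_ (ENNReal.sum_le_tsum (Finset.range N))
    rw [Finset.sum_congr rfl h1, Finset.sum_const, Finset.card_range, nsmul_eq_mul,
      ← ENNReal.ofReal_natCast, ← ENNReal.ofReal_mul (by positivity)]
    apply ENNReal.ofReal_le_ofReal
    apply max_le (by positivity)
    rw [← div_le_iff₀ hL0]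
    exact Nat.le_ceil _
  have hlint : ∫⁻ x, ENNReal.ofReal (max 0 (Real.log (a / w x))) ∂ν ≤
      ENNReal.ofReal (L / (1 - θ) * ν.real univ) := by
    calc _ ≤ ∫⁻ x, ∑' k : ℕ, ({x | w x < κ ^ k * a} : Set X).indicator
          (fun _ => ENNReal.ofReal L) x ∂ν := lintegral_mono_ae hpt
      _ = ∑' k : ℕ, ENNReal.ofReal L * ν {x | w x < κ ^ k * a} := by
          rw [lintegral_tsum fun k => (measurable_const.indicator (hEm k)).aemeasurable]
          congr 1; ext k
          rw [lintegral_indicator_const (hEm k)]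
      _ ≤ ∑' k : ℕ, ENNReal.ofReal (L * ν.real univ * θ ^ k) := by
          refine ENNReal.tsum_le_tsum fun k => ?_
          rw [← ENNReal.ofReal_toReal (measure_ne_top ν {x | w x < κ ^ k * a}),
            ← ENNReal.ofReal_mul hL0.le]
          apply ENNReal.ofReal_le_ofReal
          rw [← measureReal_def, mul_assoc, mul_comm (ν.real univ)]
          exact mul_le_mul_of_nonneg_left (hdec k) hL0.le
      _ = ENNReal.ofReal (L / (1 - θ) * ν.real univ) := by
          rw [← ENNReal.ofReal_tsum_of_nonneg (fun k => by positivity)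
            ((summable_geometric_of_lt_one hθ hθ1).mul_left _), tsum_mul_left,
            tsum_geometric_of_lt_one hθ hθ1]
          congr 1
          ring
  have hnn : 0 ≤ᵐ[ν] fun x => max 0 (Real.log (a / w x)) := ae_of_all _ fun x => le_max_left _ _
  refine ⟨⟨hmeas.aestronglyMeasurable, ?_⟩, ?_⟩
  · rw [hasFiniteIntegral_iff_ofReal hnn]
    exact hlint.trans_lt ENNReal.ofReal_lt_top
  · rw [integral_eq_lintegral_of_nonneg_ae hnn hmeas.aestronglyMeasurable]
    have : 0 ≤ L / (1 - θ) * ν.real univ :=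
      mul_nonneg (div_nonneg hL0.le (by linarith)) measureReal_nonneg
    exact ENNReal.toReal_le_of_le_ofReal this hlint

lemma logavg {X : Type*} [MeasurableSpace X] {ν : Measure X} [IsFiniteMeasure ν]
    {w : X → ℝ} (hwm : Measurable w) (hpos : ∀ᵐ x ∂ν, 0 < w x) {a D : ℝ} (ha : 0 < a)
    (hi : Integrable w ν)
    (h1 : Integrable (fun x => max 0 (Real.log (a / w x))) ν)
    (h2 : ∫ x, max 0 (Real.log (a / w x)) ∂ν ≤ D * ν.real univ) :
    Integrable (fun x => Real.log (w x)) ν ∧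
    (Real.log a - D) * ν.real univ ≤ ∫ x, Real.log (w x) ∂ν := by
  have hlow : ∀ᵐ x ∂ν, Real.log a - max 0 (Real.log (a / w x)) ≤ Real.log (w x) := by
    filter_upwards [hpos] with x hx
    have := le_max_right 0 (Real.log (a / w x))
    have h3 := Real.log_div ha.ne' hx.ne'
    linarith
  have hup : ∀ᵐ x ∂ν, Real.log (w x) ≤ w x := by
    filter_upwards [hpos] with x hx
    linarith [Real.log_le_sub_one_of_pos hx]
  have hli : Integrable (fun x => Real.log a - max 0 (Real.log (a / w x))) ν :=
    (integrable_const _).sub h1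
  have hI : Integrable (fun x => Real.log (w x)) ν :=
    integrable_of_le_of_le (Real.measurable_log.comp hwm).aestronglyMeasurable hlow hup hli hi
  refine ⟨hI, ?_⟩
  have := integral_mono_ae hli hI hlow
  rw [integral_sub (integrable_const _) h1, integral_const, smul_eq_mul] at this
  linarith

lemma decay {n : ℕ} {w : EuclideanSpace ℝ (Fin n) → ℝ} (hwm : Measurable w)
    {x0 : EuclideanSpace ℝ (Fin n)} {ρ : ℝ} (hρ : 0 < ρ)
    (hint : IntegrableOn w (Metric.ball x0 ρ))
    (hpos : ∀ᵐ x ∂(volume.restrict (Metric.ball x0 ρ)), 0 < w x)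
    {α : ℝ} (hα : 0 < α) (hα1 : α < 1)
    (H : ∀ y r, 0 < r → Metric.ball y r ⊆ Metric.ball x0 ρ → dist y x0 + r ≤ ρ →
      ∀ F ⊆ Metric.ball y r, MeasurableSet F →
      volume.real F ≤ α * volume.real (Metric.ball y r) →
      ∫ x in F, w x ≤ 1 / 2 * ∫ x in Metric.ball y r, w x)
    {a : ℝ} (ha : 0 < a)
    (haI : a * volume.real (Metric.ball x0 ρ) = ∫ x in Metric.ball x0 ρ, w x) (k : ℕ) :
    (volume.restrict (Metric.ball x0 ρ)).real {x | w x < (α / 4) ^ k * a} ≤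
      ((5 ^ n * (2 / α)) / (1 + 5 ^ n * (2 / α))) ^ k *
      (volume.restrict (Metric.ball x0 ρ)).real univ := by
  set M : ℝ := 5 ^ n * (2 / α) with hM
  have hM0 : 0 < M := by positivity
  set B := Metric.ball x0 ρ with hB
  have hBt : volume B ≠ ⊤ := measure_ball_lt_top.ne
  have hBp : 0 < volume.real B := by
    rw [hB, aux_vol _ hρ]; have := @aux_v1 n; positivity
  have hEm : ∀ c : ℝ, MeasurableSet {x | w x < c} := fun c => measurableSet_lt hwm measurable_const
  have hfin : ∀ U : Set (EuclideanSpace ℝ (Fin n)), volume (B ∩ U) ≠ ⊤ := fun U =>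
    measure_ne_top_of_subset inter_subset_left hBt
  rw [measureReal_restrict_apply_univ, measureReal_restrict_apply (hEm _), inter_comm]
  induction k with
  | zero =>
    simp only [pow_zero, one_mul]
    exact measureReal_mono inter_subset_left hBt
  | succ k ih =>
    set l := (α / 4) ^ k * a with hl
    have hl0 : 0 < l := by positivity
    have hla : l ≤ a := by
      rw [hl]
      have : (α / 4) ^ k ≤ 1 := pow_le_one₀ (by positivity) (by linarith)
      nlinarith
    have hl2 : 2 * (α / 4 * l) * volume.real B < ∫ x in B, w x := by
      rw [← haI]
      gcongr
      nlinarith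
    have hst := step hwm hρ hint hpos hα hα1 H hl0 hl2
    have hst2 := ENNReal.toReal_mono (ENNReal.mul_ne_top ENNReal.ofReal_ne_top (hfin _)) hst
    rw [ENNReal.toReal_mul, ENNReal.toReal_ofReal hM0.le, ← measureReal_def, ← measureReal_def] at hst2
    have he : (α / 4) ^ (k + 1) * a = α / 4 * l := by rw [hl]; ring
    rw [he]
    have hun : volume.real (B ∩ {x | w x < α / 4 * l}) + volume.real (B ∩ {x | α / 4 * l ≤ w x ∧ w x < l})
        ≤ volume.real (B ∩ {x | w x < l}) := by
      rw [← measureReal_union]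
      · apply measureReal_mono _ (hfin _)
        rintro x (hx | hx)
        · refine ⟨hx.1, ?_⟩
          have : w x < α / 4 * l := hx.2
          show w x < l
          nlinarith
        · exact ⟨hx.1, hx.2.2⟩
      · rw [disjoint_left]
        intro x hx hx2
        exact absurd hx.2 (not_lt.2 hx2.2.1)
      · exact measurableSet_ball.inter ((measurableSet_le measurable_const hwm).inter (hEm _))
    rw [pow_succ]
    have h3 : volume.real (B ∩ {x | w x < α / 4 * l}) ≤ M / (1 + M) * volume.real (B ∩ {x | w x < l}) := by
      rw [div_mul_eq_mul_div M, le_div_iff₀ (by positivity)]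
      nlinarith [mul_le_mul_of_nonneg_left hun hM0.le]
    calc _ ≤ _ := h3
      _ ≤ M / (1 + M) * ((M / (1 + M)) ^ k * volume.real B) := by gcongr
      _ = _ := by ring

end Aux

/-- **Corollary 5.3.** For `1 < s < ∞`: if `w ∈ RH_s = RC(1,s)`, then `w^s ∈ A_∞ = RC(0,1)`. -/
theorem rhs_pow_ainf {n : ℕ} (hn : 1 ≤ n)
    {Ω : Set (EuclideanSpace ℝ (Fin n))} (hΩ : IsOpen Ω)
    {w : EuclideanSpace ℝ (Fin n) → ℝ} (hw : IsWeight Ω w)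
    {s : ℝ} (hs : 1 < s) (h : InRC Ω w 1 ((s : ℝ) : EReal)) :
    InRC Ω (fun x => w x ^ s) 0 1 := by
  obtain ⟨C, hC, hRC⟩ := h
  obtain ⟨hwm, hwpos⟩ := hw
  have hs0 : 0 < s := by linarith
  have hsne : ((s : ℝ) : EReal) ≠ 0 := by exact_mod_cast hs0.ne'
  have h1top : (1 : EReal) ≠ ⊤ := EReal.coe_ne_top 1
  have h1bot : (1 : EReal) ≠ ⊥ := EReal.coe_ne_bot 1
  -- facts on balls
  have key : ∀ y r, 0 < r → Metric.ball y (2 * r) ⊆ Ω →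
      (∀ᵐ x ∂(volume.restrict (Metric.ball y r)), 0 < w x) ∧
      IntegrableOn w (Metric.ball y r) ∧ IntegrableOn (fun x => w x ^ s) (Metric.ball y r) ∧
      0 < ∫ x in Metric.ball y r, w x ∧ 0 < volume.real (Metric.ball y r) ∧
      ∫ x in Metric.ball y r, w x ^ s ≤
        C ^ s * ((∫ x in Metric.ball y r, w x) / volume.real (Metric.ball y r)) ^ s *
          volume.real (Metric.ball y r) := by
    intro y r hr hsub
    obtain ⟨hf1, hfs, hle⟩ := hRC (Metric.ball y r) ⟨y, r, hr, rfl, hsub⟩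
    have hf1 : IntegrableOn w (Metric.ball y r) := by
      simpa [MeanFinite, h1top, h1bot] using hf1
    have hfs : IntegrableOn (fun x => w x ^ s) (Metric.ball y r) := by
      simpa [MeanFinite, hsne, hs0.ne'] using hfs
    have hpos : ∀ᵐ x ∂(volume.restrict (Metric.ball y r)), 0 < w x := by
      rw [ae_restrict_iff' measurableSet_ball]
      filter_upwards [hwpos] with x hx hxB
      exact hx (hsub (Metric.ball_subset_ball (by linarith) hxB))
    have hbp : 0 < volume.real (Metric.ball y r) := by
      rw [aux_vol _ hr]; have := @aux_v1 n; positivity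
    have hIp : 0 < ∫ x in Metric.ball y r, w x := by
      rw [integral_pos_iff_support_of_nonneg_ae (hpos.mono fun x hx => hx.le) hf1]
      have h5 : (volume.restrict (Metric.ball y r)) (Function.support w) =
          (volume.restrict (Metric.ball y r)) Set.univ := by
        apply measure_congr
        filter_upwards [hpos] with x hx
        exact eq_true (show x ∈ Function.support w from hx.ne') |>.trans (eq_true (Set.mem_univ x)).symm
      rw [h5, Measure.restrict_apply_univ]
      exact Metric.measure_ball_pos _ _ hr
    refine ⟨hpos, hf1, hfs, hIp, hbp, ?_⟩
    have hle2 : (⨍ x in Metric.ball y r, w x ^ s) ^ (1 / s) ≤ C * ⨍ x in Metric.ball y r, w x := by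
      simpa [pMean, h1top, h1bot, hsne, hs0.ne'] using hle
    have hnn : 0 ≤ ⨍ x in Metric.ball y r, w x ^ s := by
      rw [setAverage_eq, smul_eq_mul]
      refine mul_nonneg (by positivity) (integral_nonneg_of_ae ?_)
      filter_upwards [hpos] with x hx
      simp only [Pi.zero_apply]
      positivity
    have h6 := Real.rpow_le_rpow (by positivity) hle2 hs0.le
    rw [← Real.rpow_mul hnn, one_div_mul_cancel hs0.ne', Real.rpow_one, setAverage_eq, setAverage_eq,
      smul_eq_mul, smul_eq_mul, Real.mul_rpow (by linarith) (by positivity), inv_mul_le_iff₀ hbp] at h6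
    refine h6.trans (le_of_eq ?_)
    rw [inv_mul_eq_div]; ring
  obtain ⟨α, hα, hα1, hY⟩ := young (X := EuclideanSpace ℝ (Fin n)) (μ := volume) hs hC
  set M : ℝ := 5 ^ n * (2 / α) with hM
  have hM0 : 0 < M := by positivity
  set θ := M / (1 + M) with hθ
  have hθ0 : 0 ≤ θ := by positivity
  have hθ1 : θ < 1 := by rw [hθ, div_lt_one (by positivity)]; linarith
  set D := Real.log (1 / (α / 4)) / (1 - θ) with hD
  have hD0 : 0 ≤ D := by
    apply div_nonneg _ (by linarith)
    apply Real.log_nonneg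
    rw [le_div_iff₀ (by positivity)]; linarith
  refine ⟨C ^ s * Real.exp (s * D), ?_, ?_⟩
  · have h1 : 1 ≤ C ^ s := Real.one_le_rpow hC hs0.le
    have h2 : 1 ≤ Real.exp (s * D) := Real.one_le_exp (by positivity)
    nlinarith
  rintro B ⟨x0, ρ, hρ, rfl, hsub⟩
  obtain ⟨hpos, hi, his, hI, hbp, hRH⟩ := key x0 ρ hρ hsub
  have H : ∀ y r, 0 < r → Metric.ball y r ⊆ Metric.ball x0 ρ → dist y x0 + r ≤ ρ →
      ∀ F ⊆ Metric.ball y r, MeasurableSet F →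
      volume.real F ≤ α * volume.real (Metric.ball y r) →
      ∫ x in F, w x ≤ 1 / 2 * ∫ x in Metric.ball y r, w x := by
    intro y r hr _ hyr F hF hFm hFs
    have hd : (0 : ℝ) ≤ dist y x0 := dist_nonneg
    obtain ⟨hpos, hi, his, hI, hbp, hRH⟩ := key y r hr
      ((Metric.ball_subset_ball' (by linarith)).trans hsub)
    exact hY w _ F measurableSet_ball hFm measure_ball_lt_top.ne hF hpos hi his hI hbp hRH hFs
  set a := (∫ x in Metric.ball x0 ρ, w x) / volume.real (Metric.ball x0 ρ) with ha
  have ha0 : 0 < a := by positivity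
  have haI : a * volume.real (Metric.ball x0 ρ) = ∫ x in Metric.ball x0 ρ, w x := by
    rw [ha]; field_simp
  have hdec := decay hwm hρ hi hpos hα hα1 H ha0 haI
  have : IsFiniteMeasure (volume.restrict (Metric.ball x0 ρ)) :=
    ⟨by simpa using measure_ball_lt_top⟩
  obtain ⟨hP1, hP2⟩ := logbound hwm hpos ha0 (by positivity : 0 < α / 4) (by linarith) hθ0 hθ1 hdec
  obtain ⟨hL1, hL2⟩ := logavg hwm hpos ha0 hi hP1 hP2
  rw [measureReal_restrict_apply_univ] at hL2
  have hlogs : (fun x => Real.log (w x ^ s)) =ᵐ[volume.restrict (Metric.ball x0 ρ)]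
      fun x => s * Real.log (w x) := by
    filter_upwards [hpos] with x hx
    exact Real.log_rpow hx s
  refine ⟨?_, ?_, ?_⟩
  · have : IntegrableOn (fun x => Real.log (w x ^ s)) (Metric.ball x0 ρ) :=
      (integrable_congr hlogs).2 (hL1.const_mul s)
    simpa [MeanFinite] using this
  · simpa [MeanFinite, h1top, h1bot] using his
  · have e1 : pMean (fun x => w x ^ s) 1 (Metric.ball x0 ρ) = ⨍ x in Metric.ball x0 ρ, w x ^ s := by
      simp [pMean, h1top, h1bot]
    have e0 : pMean (fun x => w x ^ s) 0 (Metric.ball x0 ρ) =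
        Real.exp (⨍ x in Metric.ball x0 ρ, Real.log (w x ^ s)) := by
      simp [pMean]
    rw [e1, e0, setAverage_eq, setAverage_eq, integral_congr_ae hlogs, integral_const_mul,
      smul_eq_mul, smul_eq_mul, mul_assoc, ← Real.exp_add]
    have h7 : (volume.real (Metric.ball x0 ρ))⁻¹ * ∫ x in Metric.ball x0 ρ, w x ^ s ≤ C ^ s * a ^ s := by
      rw [inv_mul_le_iff₀ hbp]
      linarith
    refine h7.trans ?_
    have h8 : Real.log a - D ≤ (volume.real (Metric.ball x0 ρ))⁻¹ * ∫ x in Metric.ball x0 ρ, Real.log (w x) := by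
      rw [le_inv_mul_iff₀ hbp, mul_comm]
      exact hL2
    rw [Real.rpow_def_of_pos ha0]
    gcongr
    have := mul_le_mul_of_nonneg_left h8 hs0.le
    linarith
end

section
/- (Corollary 5.4.) Fix 1 < s < ∞. If a weight w belongs to RH_s, then there exists t > s such that w belongs to RC(0, t); in particular w ∈ RH_t. -/
open MeasureTheory

section Helpers

open Filter Topology

noncomputable def treeT {N C : Type*} [Fintype C] (φ : N → ℝ) (ch : N → C → N) : ℕ → N → ℝ
  | 0, q => φ q
  | m+1, q => ∑ c, treeT φ ch m (ch q c)

theorem tree_bound {X N C : Type*} [MeasurableSpace X] [Fintype C] (cell : N → Set X)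
    (ch : N → C → N) (G : N → Prop) (a b : Set X → ℝ)
    (hG : ∀ q, G q → ∀ c, G (ch q c))
    (hm : ∀ q, MeasurableSet (cell q))
    (hun : ∀ q, G q → ⋃ c, cell (ch q c) = cell q)
    (hadda : ∀ q, G q → ∀ S : C → Set X, (∀ c, MeasurableSet (S c)) →
      (∀ c, S c ⊆ cell (ch q c)) → a (⋃ c, S c) = ∑ c, a (S c))
    (haddb : ∀ q, G q → ∀ S : C → Set X, (∀ c, MeasurableSet (S c)) →
      (∀ c, S c ⊆ cell (ch q c)) → b (⋃ c, S c) = ∑ c, b (S c))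
    (hmonob : ∀ q, G q → ∀ S ⊆ cell q, MeasurableSet S → b S ≤ b (cell q))
    (ha0 : a ∅ = 0) (hb0 : b ∅ = 0)
    (hpa : ∀ q, G q → 0 < a (cell q)) (hpb : ∀ q, G q → 0 < b (cell q))
    (D α β ε K : ℝ) (hD1 : 0 < D)
    (hD : ∀ q, G q → ∀ c, a (cell q) ≤ D * a (cell (ch q c)))
    (hα0 : 0 < α) (hα1 : α ≤ 1)
    (hAI : ∀ q, G q → ∀ S ⊆ cell q, MeasurableSet S → a S ≤ α * a (cell q) →
      b S ≤ β * b (cell q))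
    (hε : 0 < ε) (hK0 : 0 ≤ K) (hK : (1/α)^ε + K * (D/α)^ε * β ≤ K) :
    ∀ m q, G q → treeT (fun q => b (cell q) * (b (cell q) / a (cell q))^ε) ch m q ≤
      K * (b (cell q) * (b (cell q) / a (cell q))^ε) := by
  set φ : N → ℝ := fun q => b (cell q) * (b (cell q) / a (cell q))^ε with hφ
  intro m
  induction m using Nat.strong_induction_on with
  | _ m IH =>
  have inner : ∀ Λ : ℝ, 0 < Λ → ∀ m' ≤ m, ∀ q, G q → b (cell q) / a (cell q) ≤ Λ →
      ∃ S ⊆ cell q, MeasurableSet S ∧ a S * Λ ≤ b S ∧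
        treeT φ ch m' q ≤ Λ^ε * b (cell q) + K * (D * Λ)^ε * b S := by
    intro Λ hΛ m'
    induction m' with
    | zero =>
      intro _ q hq hr
      refine ⟨∅, by simp, by simp, by simp [ha0, hb0], ?_⟩
      simp only [treeT, hφ, hb0, mul_zero, add_zero]
      rw [mul_comm]
      have := hpb q hq
      have := hpa q hq
      gcongr
    | succ k ih =>
      intro hk q hq hr
      have key : ∀ c, ∃ S ⊆ cell (ch q c), MeasurableSet S ∧ a S * Λ ≤ b S ∧
        treeT φ ch k (ch q c) ≤ Λ^ε * b (cell (ch q c)) + K * (D * Λ)^ε * b S := by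
        intro c
        have hqc := hG q hq c
        by_cases hc : b (cell (ch q c)) / a (cell (ch q c)) ≤ Λ
        · exact ih (by omega) _ hqc hc
        · push Not at hc
          have p1 := hpb _ hqc
          have p2 := hpa _ hqc
          have p3 := hpb _ hq
          have p4 := hpa _ hq
          refine ⟨cell (ch q c), subset_rfl, hm _, ?_, ?_⟩
          · rw [lt_div_iff₀ p2] at hc
            linarith
          · have h1 := IH k (by omega) _ hqc
            have hmono : b (cell (ch q c)) ≤ b (cell q) := by
              apply hmonob q hq _ _ (hm _)
              rw [← hun q hq]
              exact Set.subset_iUnion (fun c => cell (ch q c)) c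
            have h2 : b (cell (ch q c)) / a (cell (ch q c)) ≤ D * Λ := by
              rw [div_le_iff₀ p2]
              rw [div_le_iff₀ p4] at hr
              have := hD q hq c
              nlinarith
            have h3 : (b (cell (ch q c)) / a (cell (ch q c)))^ε ≤ (D * Λ)^ε := by
              gcongr
            have h4 : 0 ≤ Λ^ε * b (cell (ch q c)) := by positivity
            calc _ ≤ _ := h1
              _ ≤ K * (b (cell (ch q c)) * (D * Λ)^ε) := by gcongr
              _ ≤ _ := by linarith
      choose S hS1 hS2 hS3 hS4 using key
      refine ⟨⋃ c, S c, ?_, MeasurableSet.iUnion hS2, ?_, ?_⟩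
      · rw [← hun q hq]
        exact Set.iUnion_mono hS1
      · rw [hadda q hq S hS2 hS1, haddb q hq S hS2 hS1, Finset.sum_mul]
        exact Finset.sum_le_sum fun c _ => hS3 c
      · rw [haddb q hq S hS2 hS1, ← hun q hq,
          haddb q hq (fun c => cell (ch q c)) (fun c => hm _) (fun c => subset_rfl),
          Finset.mul_sum, Finset.mul_sum, ← Finset.sum_add_distrib]
        exact Finset.sum_le_sum fun c _ => hS4 c
  intro q hq
  have p1 := hpb _ hq
  have p2 := hpa _ hq
  set l := b (cell q) / a (cell q) with hl
  have hl0 : 0 < l := by positivity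
  obtain ⟨S, hS1, hS2, hS3, hS4⟩ := inner (l * (1/α)) (by positivity) m le_rfl q hq
    (by
      have : 1 ≤ 1/α := by rw [le_div_iff₀ hα0]; linarith
      nlinarith)
  have hbS : b S ≤ β * b (cell q) := by
    apply hAI q hq S hS1 hS2
    have h1 : a S * (l * (1/α)) ≤ b (cell q) := hS3.trans (hmonob q hq S hS1 hS2)
    have h2 : b (cell q) = l * a (cell q) := by rw [hl]; field_simp
    rw [h2] at h1
    have h3 : l * (a S / α) ≤ l * a (cell q) := by
      calc _ = a S * (l * (1/α)) := by ring
        _ ≤ _ := h1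
    have h4 := le_of_mul_le_mul_left h3 hl0
    rw [div_le_iff₀ hα0] at h4
    linarith
  calc treeT φ ch m q ≤ _ := hS4
    _ ≤ (l * (1/α))^ε * b (cell q) + K * (D * (l * (1/α)))^ε * (β * b (cell q)) := by
      gcongr
    _ = ((1/α)^ε + K * (D/α)^ε * β) * (b (cell q) * l^ε) := by
      have : D * (l * (1/α)) = l * (D/α) := by ring
      rw [this, Real.mul_rpow hl0.le (by positivity), Real.mul_rpow hl0.le (by positivity)]
      ring
    _ ≤ _ := by gcongr

def cube {n : ℕ} (q : (Fin n → ℝ) × ℝ) : Set (EuclideanSpace ℝ (Fin n)) :=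
  {x | ∀ i, q.1 i ≤ x i ∧ x i < q.1 i + q.2}

noncomputable def chd {n : ℕ} (q : (Fin n → ℝ) × ℝ) (c : Fin n → Bool) : (Fin n → ℝ) × ℝ :=
  (fun i => q.1 i + if c i then q.2 / 2 else 0, q.2 / 2)

open Classical in
noncomputable def code {n : ℕ} (q : (Fin n → ℝ) × ℝ) (x : EuclideanSpace ℝ (Fin n)) :
    Fin n → Bool := fun i => decide (q.1 i + q.2 / 2 ≤ x i)

noncomputable def nodeAt {n : ℕ} : ℕ → (Fin n → ℝ) × ℝ → EuclideanSpace ℝ (Fin n) →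
    (Fin n → ℝ) × ℝ
  | 0, q, _ => q
  | m+1, q, x => nodeAt m (chd q (code q x)) x

theorem cube_eq_preimage {n : ℕ} (q : (Fin n → ℝ) × ℝ) :
    cube q = (@WithLp.ofLp 2 (Fin n → ℝ)) ⁻¹'
      (Set.univ.pi fun i => Set.Ico (q.1 i) (q.1 i + q.2)) := by
  ext x
  simp [cube]

theorem measurableSet_cube {n : ℕ} (q : (Fin n → ℝ) × ℝ) : MeasurableSet (cube q) := by
  rw [cube_eq_preimage]
  exact (PiLp.volume_preserving_ofLp (Fin n)).measurable
    (MeasurableSet.univ_pi fun i => measurableSet_Ico)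

theorem volume_cube {n : ℕ} (q : (Fin n → ℝ) × ℝ) (hq : 0 ≤ q.2) :
    volume.real (cube q) = q.2 ^ n := by
  rw [cube_eq_preimage, measureReal_def,
    (PiLp.volume_preserving_ofLp (Fin n)).measure_preimage
      (MeasurableSet.univ_pi fun i => measurableSet_Ico).nullMeasurableSet]
  rw [Real.volume_pi_Ico_toReal (by intro i; simp [hq])]
  simp

theorem code_eq {n : ℕ} {q : (Fin n → ℝ) × ℝ} {c : Fin n → Bool}
    {x : EuclideanSpace ℝ (Fin n)} (hx : x ∈ cube (chd q c)) : code q x = c := by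
  funext i
  have := hx i
  simp only [chd] at this
  cases hc : c i
  · simp [hc] at this
    simp [code]
    linarith
  · simp [hc] at this
    simp [code]
    linarith

theorem mem_chd_code {n : ℕ} {q : (Fin n → ℝ) × ℝ}
    {x : EuclideanSpace ℝ (Fin n)} (hx : x ∈ cube q) : x ∈ cube (chd q (code q x)) := by
  intro i
  have := hx i
  simp only [chd, code]
  by_cases h : q.1 i + q.2 / 2 ≤ x i
  · simp only [h, decide_true, if_true]
    constructor
    · trivial
    · linarith [this.2]
  · simp only [h, decide_false]
    push Not at h
    constructor
    · simpa using this.1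
    · simpa using h

theorem chd_subset {n : ℕ} {q : (Fin n → ℝ) × ℝ} (hq : 0 < q.2) (c : Fin n → Bool) :
    cube (chd q c) ⊆ cube q := by
  intro x hx i
  have := hx i
  simp only [chd] at this
  cases hc : c i <;> simp [hc] at this <;> constructor <;> linarith

theorem cube_union {n : ℕ} {q : (Fin n → ℝ) × ℝ} (hq : 0 < q.2) :
    ⋃ c, cube (chd q c) = cube q := by
  apply subset_antisymm
  · exact Set.iUnion_subset fun c => chd_subset hq c
  · intro x hx
    exact Set.mem_iUnion.2 ⟨_, mem_chd_code hx⟩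

theorem cube_disj {n : ℕ} (q : (Fin n → ℝ) × ℝ) :
    Pairwise (Function.onFun Disjoint fun c => cube (chd q c)) := by
  intro c d hcd
  refine Set.disjoint_left.2 fun x hx hy => hcd ?_
  rw [← code_eq hx, ← code_eq hy]

theorem nodeAt_mem {n : ℕ} (m : ℕ) : ∀ (q : (Fin n → ℝ) × ℝ) (x : EuclideanSpace ℝ (Fin n)),
    x ∈ cube q → x ∈ cube (nodeAt m q x) := by
  induction m with
  | zero => intro q x hx; exact hx
  | succ m ih => intro q x hx; exact ih _ _ (mem_chd_code hx)

theorem nodeAt_side {n : ℕ} (m : ℕ) : ∀ (q : (Fin n → ℝ) × ℝ) (x : EuclideanSpace ℝ (Fin n)),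
    (nodeAt m q x).2 = q.2 * (1/2)^m := by
  induction m with
  | zero => intro q x; simp [nodeAt]
  | succ m ih => intro q x; simp only [nodeAt]; rw [ih]; simp [chd]; ring

theorem nodeAt_subset {n : ℕ} (m : ℕ) : ∀ (q : (Fin n → ℝ) × ℝ) (x : EuclideanSpace ℝ (Fin n)),
    0 < q.2 → cube (nodeAt m q x) ⊆ cube q := by
  induction m with
  | zero => intro q x _; exact subset_rfl
  | succ m ih =>
    intro q x hq
    exact (ih _ _ (by simp [chd, hq])).trans (chd_subset hq _)

theorem measurable_code {n : ℕ} (q : (Fin n → ℝ) × ℝ) : Measurable (code q) := by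
  classical
  refine measurable_pi_iff.2 fun i => ?_
  have hs : MeasurableSet {x : EuclideanSpace ℝ (Fin n) | q.1 i + q.2 / 2 ≤ x i} :=
    measurableSet_le measurable_const (by fun_prop)
  refine measurable_to_bool ?_
  convert hs using 1
  ext x
  simp [code]

theorem measurable_nodeAt {n : ℕ} (ψ : (Fin n → ℝ) × ℝ → ℝ) (m : ℕ) :
    ∀ q : (Fin n → ℝ) × ℝ, Measurable fun x => ψ (nodeAt m q x) := by
  induction m with
  | zero => intro q; simp only [nodeAt]; exact measurable_const
  | succ m ih =>
    intro q
    have h : Measurable (fun p : (Fin n → Bool) × EuclideanSpace ℝ (Fin n) =>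
        ψ (nodeAt m (chd q p.1) p.2)) :=
      measurable_from_prod_countable_right fun c => ih (chd q c)
    exact h.comp ((measurable_code q).prodMk measurable_id)

theorem lintegral_node {n : ℕ} (v : EuclideanSpace ℝ (Fin n) → ℝ)
    (hv0 : ∀ x, 0 < v x) (ψ : (Fin n → ℝ) × ℝ → ℝ)
    (hψ : ∀ q, 0 ≤ ψ q) (m : ℕ) : ∀ q : (Fin n → ℝ) × ℝ, 0 < q.2 → IntegrableOn v (cube q) →
    ∫⁻ x in cube q, ENNReal.ofReal (ψ (nodeAt m q x) * v x) =
      ENNReal.ofReal (treeT (fun q => (∫ x in cube q, v x) * ψ q) chd m q) := by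
  have tn : ∀ m q, 0 ≤ treeT (fun q : (Fin n → ℝ) × ℝ => (∫ x in cube q, v x) * ψ q) chd m q := by
    intro m
    induction m with
    | zero =>
      intro q
      exact mul_nonneg (integral_nonneg fun x => (hv0 x).le) (hψ q)
    | succ m ih => intro q; exact Finset.sum_nonneg fun c _ => ih _
  induction m with
  | zero =>
    intro q hq hi
    simp only [nodeAt, treeT]
    rw [← ofReal_integral_eq_lintegral_ofReal (hi.const_mul _)
      (ae_of_all _ fun x => mul_nonneg (hψ q) (hv0 x).le), integral_const_mul, mul_comm]
  | succ m ih =>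
    intro q hq hi
    simp only [treeT]
    rw [ENNReal.ofReal_sum_of_nonneg (fun c _ => tn _ _), ← cube_union hq,
      lintegral_iUnion (fun c => measurableSet_cube _) (cube_disj q), tsum_fintype]
    refine Finset.sum_congr rfl fun c _ => ?_
    rw [← ih (chd q c) (by simp [chd, hq]) (hi.mono_set (chd_subset hq c))]
    refine setLIntegral_congr_fun (measurableSet_cube _) fun x hx => ?_
    simp only [nodeAt, code_eq hx]

theorem cube_diff {n : ℕ} (g : EuclideanSpace ℝ (Fin n) → ℝ) (hg : Integrable g) :
    ∀ᵐ x, ∀ Q : ℕ → (Fin n → ℝ) × ℝ, (∀ m, 0 < (Q m).2) →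
      Tendsto (fun m => (Q m).2) atTop (𝓝 0) → (∀ m, x ∈ cube (Q m)) →
      Tendsto (fun m => (∫ y in cube (Q m), g y) / (Q m).2 ^ n) atTop (𝓝 (g x)) := by
  have mp := PiLp.volume_preserving_toLp (Fin n)
  have mp' := PiLp.volume_preserving_ofLp (Fin n)
  have hg' : Integrable (fun y : Fin n → ℝ => g (WithLp.toLp 2 y)) :=
    mp.integrable_comp_of_integrable hg
  have h := IsUnifLocDoublingMeasure.ae_tendsto_average (μ := (volume : Measure (Fin n → ℝ)))
    hg'.locallyIntegrable 1
  have h2 := mp'.quasiMeasurePreserving.ae h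
  filter_upwards [h2] with x hx Q hQ hQ0 hxQ
  have hlim : Tendsto (fun m => (Q m).2 / 2) atTop (𝓝[>] 0) := by
    refine tendsto_nhdsWithin_iff.2 ⟨by simpa using hQ0.div_const 2, ?_⟩
    exact Eventually.of_forall fun m => by simpa using hQ m
  have hset : ∀ m, Metric.closedBall (fun i => (Q m).1 i + (Q m).2 / 2) ((Q m).2 / 2) =
      Set.Icc (Q m).1 (fun i => (Q m).1 i + (Q m).2) := by
    intro m
    rw [closedBall_pi _ (by linarith [hQ m]), ← Set.pi_univ_Icc]
    congr 1
    funext i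
    rw [Real.closedBall_eq_Icc]
    congr 1 <;> ring
  have := hx (fun m i => (Q m).1 i + (Q m).2 / 2) (fun m => (Q m).2 / 2) hlim
    (Eventually.of_forall fun m => by
      rw [one_mul, hset]
      exact ⟨fun i => (hxQ m i).1, fun i => (hxQ m i).2.le⟩)
  refine this.congr fun m => ?_
  rw [hset, setAverage_eq]
  have e1 : volume.real (Set.Icc (Q m).1 (fun i => (Q m).1 i + (Q m).2)) = (Q m).2 ^ n := by
    rw [measureReal_def, Real.volume_Icc_pi_toReal (by intro i; simp [(hQ m).le])]
    simp
  have e2 : ∫ y in Set.Icc (Q m).1 (fun i => (Q m).1 i + (Q m).2), g (WithLp.toLp 2 y) =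
      ∫ y in cube (Q m), g y := by
    have hae : (Set.univ.pi fun i => Set.Ico ((Q m).1 i) ((Q m).1 i + (Q m).2)) =ᵐ[volume]
      Set.Icc (Q m).1 (fun i => (Q m).1 i + (Q m).2) := Measure.univ_pi_Ico_ae_eq_Icc
    rw [← setIntegral_congr_set hae, cube_eq_preimage,
      ← mp'.setIntegral_preimage_emb (MeasurableEquiv.toLp 2 (Fin n → ℝ)).symm.measurableEmbedding]
  rw [e1, e2, smul_eq_mul]
  ring

theorem cube_RH {n : ℕ} (u v : EuclideanSpace ℝ (Fin n) → ℝ)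
    (hvm : Measurable v) (hu0 : ∀ x, 0 < u x) (hv0 : ∀ x, 0 < v x)
    (G : (Fin n → ℝ) × ℝ → Prop) (hG : ∀ q, G q → ∀ c, G (chd q c))
    (hGp : ∀ q, G q → 0 < q.2)
    (hGu : ∀ q, G q → IntegrableOn u (cube q)) (hGv : ∀ q, G q → IntegrableOn v (cube q))
    (D α β ε K : ℝ) (hD1 : 0 < D)
    (hD : ∀ q, G q → ∀ c, (∫ x in cube q, u x) ≤ D * ∫ x in cube (chd q c), u x)
    (hα0 : 0 < α) (hα1 : α ≤ 1)
    (hAI : ∀ q, G q → ∀ S ⊆ cube q, MeasurableSet S →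
      (∫ x in S, u x) ≤ α * (∫ x in cube q, u x) → (∫ x in S, v x) ≤ β * (∫ x in cube q, v x))
    (hε : 0 < ε) (hK0 : 0 ≤ K) (hK : (1/α)^ε + K * (D/α)^ε * β ≤ K) (q : (Fin n → ℝ) × ℝ)
    (hq : G q) :
    ∫⁻ x in cube q, ENNReal.ofReal ((v x / u x)^ε * v x) ≤ ENNReal.ofReal
      (K * ((∫ x in cube q, v x) * ((∫ x in cube q, v x) / (∫ x in cube q, u x))^ε)) := by
  have pos : ∀ f : EuclideanSpace ℝ (Fin n) → ℝ, (∀ x, 0 < f x) → ∀ q : (Fin n → ℝ) × ℝ,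
      0 < q.2 → IntegrableOn f (cube q) → 0 < ∫ x in cube q, f x := by
    intro f hf q hq hi
    rw [setIntegral_pos_iff_support_of_nonneg_ae (ae_of_all _ fun x => (hf x).le) hi]
    have : Function.support f = Set.univ := by
      ext x; simpa using (hf x).ne'
    rw [this, Set.univ_inter]
    have h1 := volume_cube q hq.le
    have h2 : 0 < volume.real (cube q) := by rw [h1]; positivity
    rw [measureReal_def] at h2
    exact (ENNReal.toReal_pos_iff.1 h2).1
  have add : ∀ f : EuclideanSpace ℝ (Fin n) → ℝ, (∀ q, G q → IntegrableOn f (cube q)) →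
      ∀ q, G q → ∀ S : (Fin n → Bool) → Set (EuclideanSpace ℝ (Fin n)),
      (∀ c, MeasurableSet (S c)) →
      (∀ c, S c ⊆ cube (chd q c)) → ∫ x in (⋃ c, S c), f x = ∑ c, ∫ x in S c, f x := by
    intro f hf q hq S hS hS2
    refine integral_iUnion_fintype hS ?_ ?_
    · intro c d hcd
      exact (cube_disj q hcd).mono (hS2 c) (hS2 d)
    · intro c
      exact (hf _ (hG q hq c)).mono_set (hS2 c)
  have tb := tree_bound cube chd G (fun S => ∫ x in S, u x) (fun S => ∫ x in S, v x) hG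
    measurableSet_cube (fun q hq => cube_union (hGp q hq)) (add u hGu) (add v hGv)
    (fun q hq S hS _ => setIntegral_mono_set (hGv q hq) (ae_of_all _ fun x => (hv0 x).le)
      (Eventually.of_forall hS)) (by simp) (by simp)
    (fun q hq => pos u hu0 q (hGp q hq) (hGu q hq))
    (fun q hq => pos v hv0 q (hGp q hq) (hGv q hq)) D α β ε K hD1 hD hα0 hα1 hAI hε hK0 hK
  set ψ : (Fin n → ℝ) × ℝ → ℝ := fun q => ((∫ x in cube q, v x) / (∫ x in cube q, u x))^ε with hψ
  have hψ0 : ∀ q, 0 ≤ ψ q := fun q => Real.rpow_nonneg (div_nonneg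
    (integral_nonneg fun x => (hv0 x).le) (integral_nonneg fun x => (hu0 x).le)) _
  have hb : ∀ m, ∫⁻ x in cube q, ENNReal.ofReal (ψ (nodeAt m q x) * v x) ≤ ENNReal.ofReal
      (K * ((∫ x in cube q, v x) * ((∫ x in cube q, v x) / (∫ x in cube q, u x))^ε)) := by
    intro m
    rw [lintegral_node v hv0 ψ hψ0 m q (hGp q hq) (hGv q hq)]
    exact ENNReal.ofReal_le_ofReal (tb m q hq)
  have hdiff : ∀ f : EuclideanSpace ℝ (Fin n) → ℝ, IntegrableOn f (cube q) →
      ∀ᵐ x ∂(volume.restrict (cube q)), Tendsto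
        (fun m => (∫ y in cube (nodeAt m q x), f y) / (nodeAt m q x).2 ^ n) atTop (𝓝 (f x)) := by
    intro f hf
    have h1 := cube_diff ((cube q).indicator f) (hf.integrable_indicator (measurableSet_cube q))
    rw [ae_restrict_iff' (measurableSet_cube q)]
    filter_upwards [h1] with x hx hxq
    have h2 := hx (fun m => nodeAt m q x) (fun m => by
        rw [nodeAt_side]; have := hGp q hq; positivity)
      (by
        simp only [nodeAt_side]
        simpa using (tendsto_pow_atTop_nhds_zero_of_lt_one (r := (1/2:ℝ)) (by norm_num)
          (by norm_num)).const_mul q.2) (fun m => nodeAt_mem m q x hxq)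
    rw [Set.indicator_of_mem hxq] at h2
    refine h2.congr fun m => ?_
    rw [setIntegral_indicator (measurableSet_cube q),
      Set.inter_eq_left.2 (nodeAt_subset m q x (hGp q hq))]
  have hlim : ∀ᵐ x ∂(volume.restrict (cube q)), Tendsto
      (fun m => ENNReal.ofReal (ψ (nodeAt m q x) * v x)) atTop
      (𝓝 (ENNReal.ofReal ((v x / u x)^ε * v x))) := by
    filter_upwards [hdiff u (hGu q hq), hdiff v (hGv q hq)] with x h1 h2
    refine (ENNReal.continuous_ofReal.tendsto _).comp ?_
    refine Tendsto.mul_const _ ?_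
    have h3 := (h2.div h1 (hu0 x).ne').rpow_const (p := ε) (Or.inr hε.le)
    refine h3.congr fun m => ?_
    simp only [hψ, Pi.div_apply]
    congr 1
    have : (nodeAt m q x).2 ^ n ≠ 0 := by
      rw [nodeAt_side]; have := hGp q hq; positivity
    field_simp
  calc ∫⁻ x in cube q, ENNReal.ofReal ((v x / u x)^ε * v x)
      = ∫⁻ x in cube q, liminf (fun m => ENNReal.ofReal (ψ (nodeAt m q x) * v x)) atTop := by
        refine lintegral_congr_ae ?_
        filter_upwards [hlim] with x hx
        exact hx.liminf_eq.symm
    _ ≤ liminf (fun m => ∫⁻ x in cube q, ENNReal.ofReal (ψ (nodeAt m q x) * v x)) atTop :=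
        lintegral_liminf_le fun m => ((measurable_nodeAt ψ m q).mul hvm).ennreal_ofReal
    _ ≤ _ := by
        refine liminf_le_of_frequently_le' (Frequently.of_forall hb)

def RHon {n : ℕ} (w : EuclideanSpace ℝ (Fin n) → ℝ) (s C : ℝ)
    (B : Set (EuclideanSpace ℝ (Fin n))) : Prop :=
  MeasurableSet B ∧ volume B ≠ ⊤ ∧ 0 < volume.real B ∧ IntegrableOn w B ∧
    IntegrableOn (fun x => w x ^ s) B ∧
    ∫ x in B, w x ^ s ≤ C * (volume.real B * ((∫ x in B, w x) / volume.real B) ^ s)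

theorem young_aux {s M y : ℝ} (hs : 1 < s) (hM : 0 < M) (hy : 0 < y) :
    y ≤ M + M ^ (1 - s) * y ^ s := by
  rcases le_total y M with h | h
  · have : 0 ≤ M ^ (1 - s) * y ^ s := by positivity
    linarith
  · have h1 : y ^ (1 - s) ≤ M ^ (1 - s) :=
      Real.rpow_le_rpow_of_nonpos hM h (by linarith)
    have h2 : y = y ^ (1 - s) * y ^ s := by
      rw [← Real.rpow_add hy]; simp
    have h3 : y ^ (1 - s) * y ^ s ≤ M ^ (1 - s) * y ^ s := by gcongr
    linarith

theorem young_int {n : ℕ} {w : EuclideanSpace ℝ (Fin n) → ℝ} (hw0 : ∀ x, 0 < w x) {s M C : ℝ}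
    (hs : 1 < s) (hM : 0 < M) {B S : Set (EuclideanSpace ℝ (Fin n))} (hB : RHon w s C B)
    (hS : S ⊆ B) :
    ∫ x in S, w x ≤ M * volume.real S + M ^ (1 - s) * ∫ x in S, w x ^ s := by
  obtain ⟨h1, h2, h3, h4, h5, h6⟩ := hB
  have hv : volume S ≠ ⊤ := ne_top_of_le_ne_top h2 (measure_mono hS)
  have i1 : IntegrableOn (fun _ : EuclideanSpace ℝ (Fin n) => M) S := integrableOn_const hv
  have i2 := (h5.mono_set hS).const_mul (M ^ (1-s))
  calc ∫ x in S, w x ≤ ∫ x in S, (M + M ^ (1 - s) * w x ^ s) :=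
        integral_mono (h4.mono_set hS) (i1.add i2) fun x => young_aux hs hM (hw0 x)
    _ = _ := by
        rw [integral_add i1 i2, integral_const_mul]
        simp [mul_comm]

theorem RHon.pos {n : ℕ} {w : EuclideanSpace ℝ (Fin n) → ℝ} (hw0 : ∀ x, 0 < w x) {s C : ℝ}
    {B : Set (EuclideanSpace ℝ (Fin n))} (hB : RHon w s C B) : 0 < ∫ x in B, w x := by
  obtain ⟨h1, h2, h3, h4, h5, h6⟩ := hB
  rw [setIntegral_pos_iff_support_of_nonneg_ae (ae_of_all _ fun x => (hw0 x).le) h4]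
  have : Function.support w = Set.univ := by
    ext x; simpa using (hw0 x).ne'
  rw [this, Set.univ_inter]
  rw [measureReal_def] at h3
  exact (ENNReal.toReal_pos_iff.1 h3).1

theorem small_setW {n : ℕ} {w : EuclideanSpace ℝ (Fin n) → ℝ} (hw0 : ∀ x, 0 < w x) {s C : ℝ}
    (hs : 1 < s) (hC : 1 ≤ C) {η : ℝ} (hη : 0 < η) :
    ∃ δ : ℝ, 0 < δ ∧ ∀ B S : Set (EuclideanSpace ℝ (Fin n)), RHon w s C B → S ⊆ B →
      volume.real S ≤ δ * volume.real B → ∫ x in S, w x ≤ η * ∫ x in B, w x := by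
  obtain ⟨L, hL0, hL⟩ : ∃ L : ℝ, 0 < L ∧ L ^ (1 - s) * C ≤ η / 2 := by
    have h1 : Tendsto (fun L : ℝ => L ^ (1 - s) * C) atTop (𝓝 (0 * C)) := by
      have := tendsto_rpow_neg_atTop (y := s - 1) (by linarith)
      simp only [neg_sub] at this
      exact this.mul_const C
    rw [zero_mul] at h1
    have h2 := h1.eventually (eventually_le_nhds (show (0:ℝ) < η/2 by positivity))
    exact ((eventually_gt_atTop 0).and h2).exists
  refine ⟨η / (2 * L), by positivity, fun B S hB hS hV => ?_⟩
  have hW := hB.pos hw0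
  have hVB := hB.2.2.1
  have hB6 := hB.2.2.2.2.2
  set W := ∫ x in B, w x
  set V := volume.real B
  have hM : 0 < L * (W / V) := by positivity
  have h1 := young_int hw0 hs hM hB hS
  have h2 : ∫ x in S, w x ^ s ≤ ∫ x in B, w x ^ s :=
    setIntegral_mono_set hB.2.2.2.2.1 (ae_of_all _ fun x => (Real.rpow_pos_of_pos (hw0 x) _).le)
      (Eventually.of_forall hS)
  have h3 : (L * (W/V)) ^ (1-s) * ∫ x in S, w x ^ s ≤ η / 2 * W := by
    calc _ ≤ (L * (W/V)) ^ (1-s) * (C * (V * (W/V)^s)) := by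
          gcongr
          exact h2.trans hB6
      _ = L ^ (1-s) * C * (V * ((W/V)^(1-s) * (W/V)^s)) := by
          rw [Real.mul_rpow hL0.le (by positivity)]; ring
      _ = L ^ (1-s) * C * W := by
          rw [← Real.rpow_add (by positivity), sub_add_cancel, Real.rpow_one]
          congr 1
          field_simp
      _ ≤ _ := by gcongr
  have h4 : L * (W/V) * volume.real S ≤ η / 2 * W := by
    calc _ ≤ L * (W/V) * (η / (2*L) * V) := by gcongr
      _ = _ := by field_simp
  linarith

theorem AI_one {n : ℕ} {w : EuclideanSpace ℝ (Fin n) → ℝ} (hw0 : ∀ x, 0 < w x) {s C : ℝ}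
    (hs : 1 < s) (hC : 1 ≤ C) :
    ∃ α β : ℝ, 0 < α ∧ α ≤ 1 ∧ β < 1 ∧ ∀ B S : Set (EuclideanSpace ℝ (Fin n)), RHon w s C B →
      S ⊆ B → MeasurableSet S → volume.real S ≤ α * volume.real B →
      ∫ x in S, w x ^ s ≤ β * ∫ x in B, w x ^ s := by
  obtain ⟨δ, hδ, H⟩ := small_setW hw0 hs hC (η := 1/2) (by norm_num)
  refine ⟨min δ 1, 1 - (4:ℝ)^(-s) / C, by positivity, min_le_right _ _, ?_, ?_⟩
  · have : 0 < (4:ℝ)^(-s) / C := by positivity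
    linarith
  intro B S hB hS hSm hV
  have hW := hB.pos hw0
  have hVB := hB.2.2.1
  have hB6 := hB.2.2.2.2.2
  have h1 := H B S hB hS (hV.trans (by gcongr; exact min_le_left _ _))
  have h2 : ∫ x in B \ S, w x = (∫ x in B, w x) - ∫ x in S, w x :=
    setIntegral_sdiff hSm hB.2.2.2.1 hS
  have h3 : ∫ x in B \ S, w x ^ s = (∫ x in B, w x ^ s) - ∫ x in S, w x ^ s :=
    setIntegral_sdiff hSm hB.2.2.2.2.1 hS
  set W := ∫ x in B, w x
  set V := volume.real B
  have h4 := young_int hw0 hs (show 0 < W / V / 4 by positivity) hB (S := B \ S) Set.sdiff_subset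
  have h5 : volume.real (B \ S) ≤ V := measureReal_mono Set.sdiff_subset hB.2.1
  have h6 : W / V / 4 * volume.real (B \ S) ≤ W / 4 := by
    calc _ ≤ W / V / 4 * V := by gcongr
      _ = _ := by field_simp
  have h7 : W / 4 ≤ (W/V/4)^(1-s) * ∫ x in B \ S, w x ^ s := by linarith
  have h8 : (4:ℝ)^(-s) * (V * (W/V)^s) ≤ ∫ x in B \ S, w x ^ s := by
    have e : (W/V/4)^(s-1) * (W/V/4)^(1-s) = 1 := by
      rw [← Real.rpow_add (by positivity)]; simp
    calc (4:ℝ)^(-s) * (V * (W/V)^s) = (W/V/4)^(s-1) * (W/4) := by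
          rw [Real.rpow_sub (by positivity),
            Real.div_rpow (show 0 ≤ W / V by positivity) (show (0:ℝ) ≤ 4 by positivity),
            Real.rpow_neg (by positivity), Real.rpow_one]
          generalize (W/V)^s = z
          field_simp
      _ ≤ (W/V/4)^(s-1) * ((W/V/4)^(1-s) * ∫ x in B \ S, w x ^ s) := by gcongr
      _ = _ := by rw [← mul_assoc, e, one_mul]
  have h9 : (4:ℝ)^(-s) / C * ∫ x in B, w x ^ s ≤ (4:ℝ)^(-s) * (V * (W/V)^s) := by
    calc _ ≤ (4:ℝ)^(-s) / C * (C * (V * (W/V)^s)) := by gcongr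
      _ = _ := by field_simp
  linarith

theorem AI_two {n : ℕ} {w : EuclideanSpace ℝ (Fin n) → ℝ} (hw0 : ∀ x, 0 < w x) {s C : ℝ}
    (hs : 1 < s) (hC : 1 ≤ C) :
    ∃ β : ℝ, β < 1 ∧ ∀ B S : Set (EuclideanSpace ℝ (Fin n)), RHon w s C B →
      S ⊆ B → MeasurableSet S → ∫ x in S, w x ≤ 1/3 * ∫ x in B, w x →
      volume.real S ≤ β * volume.real B := by
  obtain ⟨δ, hδ, H⟩ := small_setW hw0 hs hC (η := 1/2) (by norm_num)
  refine ⟨1 - δ, by linarith, ?_⟩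
  intro B S hB hS hSm hV
  have hW := hB.pos hw0
  by_contra hcon
  push Not at hcon
  have h5 : volume.real (B \ S) = volume.real B - volume.real S := measureReal_sdiff hS hSm
    hB.2.1
  have h1 := H B (B \ S) hB Set.sdiff_subset (by linarith)
  have h2 : ∫ x in B \ S, w x = (∫ x in B, w x) - ∫ x in S, w x :=
    setIntegral_sdiff hSm hB.2.2.2.1 hS
  linarith

theorem exists_eps {D α β : ℝ} (hD : 0 < D) (hα : 0 < α) (hβ : β < 1) :
    ∃ ε K : ℝ, 0 < ε ∧ 0 ≤ K ∧ (1/α)^ε + K * (D/α)^ε * β ≤ K := by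
  have h1 : Tendsto (fun ε : ℝ => (D/α)^ε * β) (𝓝[>] 0) (𝓝 β) := by
    have : Continuous fun ε : ℝ => (D/α)^ε * β :=
      (Real.continuous_const_rpow (by positivity)).mul continuous_const
    have h := this.tendsto 0
    simp only [Real.rpow_zero, one_mul] at h
    exact h.mono_left nhdsWithin_le_nhds
  obtain ⟨ε, h2, h3⟩ := ((h1.eventually (eventually_lt_nhds hβ)).and
    self_mem_nhdsWithin).exists
  have h4 : 0 < 1 - (D/α)^ε * β := by linarith
  refine ⟨ε, (1/α)^ε / (1 - (D/α)^ε * β), h3, by positivity, le_of_eq ?_⟩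
  field_simp
  ring

theorem vol_ball_mul {n : ℕ} (x : EuclideanSpace ℝ (Fin n)) {θ : ℝ} (hθ : 0 < θ) (ρ : ℝ) :
    volume.real (Metric.ball x (θ * ρ)) = θ ^ n * volume.real (Metric.ball x ρ) := by
  rw [measureReal_def, Measure.addHaar_ball_mul_of_pos _ _ hθ, ENNReal.toReal_mul,
    ENNReal.toReal_ofReal (by positivity), Measure.addHaar_real_ball_center, measureReal_def]
  simp

theorem doubling {n : ℕ} {w : EuclideanSpace ℝ (Fin n) → ℝ} (hw0 : ∀ x, 0 < w x)
    {Ω : Set (EuclideanSpace ℝ (Fin n))} {s C : ℝ}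
    (hs : 1 < s) (hC : 1 ≤ C)
    (hB : ∀ x ρ, 0 < ρ → Metric.ball x (2 * ρ) ⊆ Ω → RHon w s C (Metric.ball x ρ))
    {κ : ℝ} (hκ : 0 < κ) (hk1 : κ ≤ 1) :
    ∃ D : ℝ, 0 < D ∧ ∀ x ρ, 0 < ρ → Metric.ball x (2 * ρ) ⊆ Ω →
      ∫ y in Metric.ball x ρ, w y ≤ D * ∫ y in Metric.ball x (κ * ρ), w y := by
  obtain ⟨δ, hδ, H⟩ := small_setW hw0 hs hC (η := 1/2) (by norm_num)
  obtain ⟨θ, hθ0, hθ1, hθ⟩ : ∃ θ : ℝ, 0 < θ ∧ θ < 1 ∧ 1 - δ < θ ^ n := by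
    have h1 : Tendsto (fun θ : ℝ => θ ^ n) (𝓝[<] 1) (𝓝 1) := by
      have := (continuous_pow (M := ℝ) n).tendsto 1
      simp only [one_pow] at this
      exact this.mono_left nhdsWithin_le_nhds
    have h2 : ∀ᶠ θ : ℝ in 𝓝[<] 1, 0 < θ :=
      nhdsWithin_le_nhds (eventually_gt_nhds (by norm_num))
    have h3 : ∀ᶠ θ : ℝ in 𝓝[<] 1, θ < 1 := self_mem_nhdsWithin
    obtain ⟨θ, a, b, c⟩ := (h2.and (h3.and
      (h1.eventually (eventually_gt_nhds (show 1 - δ < 1 by linarith))))).exists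
    exact ⟨θ, a, b, c⟩
  have step : ∀ x ρ, 0 < ρ → Metric.ball x (2 * ρ) ⊆ Ω →
      ∫ y in Metric.ball x ρ, w y ≤ 2 * ∫ y in Metric.ball x (θ * ρ), w y := by
    intro x ρ hρ hx
    have hb := hB x ρ hρ hx
    have hsub : Metric.ball x (θ * ρ) ⊆ Metric.ball x ρ := Metric.ball_subset_ball (by nlinarith)
    have h5 : volume.real (Metric.ball x ρ \ Metric.ball x (θ * ρ)) =
        volume.real (Metric.ball x ρ) - volume.real (Metric.ball x (θ * ρ)) :=
      measureReal_sdiff hsub measurableSet_ball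
        hb.2.1
    have hp := hb.2.2.1
    have h1 := H _ (Metric.ball x ρ \ Metric.ball x (θ * ρ)) hb Set.sdiff_subset (by
      rw [h5, vol_ball_mul x hθ0]
      nlinarith)
    rw [setIntegral_sdiff measurableSet_ball hb.2.2.2.1 hsub] at h1
    linarith
  have iter : ∀ m : ℕ, ∀ x ρ, 0 < ρ → Metric.ball x (2 * ρ) ⊆ Ω →
      ∫ y in Metric.ball x ρ, w y ≤ 2^m * ∫ y in Metric.ball x (θ^m * ρ), w y := by
    intro m
    induction m with
    | zero => intro x ρ _ _; simp
    | succ m ih =>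
      intro x ρ hρ hx
      have hle : θ ^ m ≤ 1 := pow_le_one₀ hθ0.le hθ1.le
      have h1 := ih x ρ hρ hx
      have h2 := step x (θ^m * ρ) (by positivity)
        ((Metric.ball_subset_ball (by nlinarith)).trans hx)
      rw [← mul_assoc, ← pow_succ'] at h2
      calc _ ≤ _ := h1
        _ ≤ 2^m * (2 * ∫ y in Metric.ball x (θ^(m+1) * ρ), w y) := by gcongr
        _ = _ := by ring
  obtain ⟨m, hm⟩ := exists_pow_lt_of_lt_one hκ hθ1
  · refine ⟨2^m, by positivity, fun x ρ hρ hx => (iter m x ρ hρ hx).trans ?_⟩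
    refine mul_le_mul_of_nonneg_left ?_ (by positivity)
    refine setIntegral_mono_set ?_ (ae_of_all _ fun x => (hw0 x).le)
      (Eventually.of_forall (Metric.ball_subset_ball (by nlinarith)))
    exact (hB x ρ hρ hx).2.2.2.1.mono_set (Metric.ball_subset_ball (by nlinarith))

def GoodCube {n : ℕ} (Ω : Set (EuclideanSpace ℝ (Fin n))) (q : (Fin n → ℝ) × ℝ) : Prop :=
  0 < q.2 ∧ ∀ x ∈ cube q, Metric.ball x (2 * (n * q.2)) ⊆ Ω

noncomputable def ctr {n : ℕ} (q : (Fin n → ℝ) × ℝ) : EuclideanSpace ℝ (Fin n) :=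
  WithLp.toLp 2 fun i => q.1 i + q.2 / 2

theorem ctr_mem {n : ℕ} {q : (Fin n → ℝ) × ℝ} (hq : 0 < q.2) : ctr q ∈ cube q := by
  intro i
  simp only [ctr]
  constructor <;> linarith

theorem dist_lt_of_coord {n : ℕ} (hn : 1 ≤ n) {x y : EuclideanSpace ℝ (Fin n)} {l : ℝ}
    (hl : 0 < l) (h : ∀ i, |x i - y i| ≤ 3 / 4 * l) : dist x y < n * l := by
  have hn' : (1:ℝ) ≤ n := by exact_mod_cast hn
  rw [EuclideanSpace.dist_eq]
  have h1 : ∑ i, dist (x i) (y i) ^ 2 ≤ ∑ _i : Fin n, (3/4*l)^2 := by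
    refine Finset.sum_le_sum fun i _ => ?_
    rw [Real.dist_eq]
    exact pow_le_pow_left₀ (abs_nonneg _) (h i) 2
  rw [Finset.sum_const, Finset.card_univ, Fintype.card_fin, nsmul_eq_mul] at h1
  rw [Real.sqrt_lt' (by positivity)]
  have h2 : (n:ℝ) * 1 ≤ n * n := by gcongr
  have : 0 < l^2 := by positivity
  nlinarith

theorem ball_sub_cube {n : ℕ} {q : (Fin n → ℝ) × ℝ} :
    Metric.ball (ctr q) (q.2 / 2) ⊆ cube q := by
  intro x hx i
  rw [Metric.mem_ball, dist_eq_norm] at hx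
  have h1 := (PiLp.norm_apply_le (x - ctr q) i).trans_lt hx
  simp only [ctr, PiLp.sub_apply, Real.norm_eq_abs, abs_lt] at h1
  constructor <;> linarith

theorem cube_sub_ball {n : ℕ} (hn : 1 ≤ n) {q : (Fin n → ℝ) × ℝ} (hq : 0 < q.2) :
    cube q ⊆ Metric.ball (ctr q) (n * q.2) := by
  intro x hx
  refine dist_lt_of_coord hn hq fun i => ?_
  have := hx i
  simp only [ctr, abs_le]
  constructor <;> linarith

theorem cube_sub_ball_chd {n : ℕ} (hn : 1 ≤ n) {q : (Fin n → ℝ) × ℝ} (hq : 0 < q.2)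
    (c : Fin n → Bool) :
    cube q ⊆ Metric.ball (ctr (chd q c)) (n * q.2) := by
  intro x hx
  refine dist_lt_of_coord hn hq fun i => ?_
  have := hx i
  simp only [ctr, chd, abs_le]
  cases c i <;> simp <;> constructor <;> linarith

theorem GoodCube.chd {n : ℕ} {Ω : Set (EuclideanSpace ℝ (Fin n))} {q : (Fin n → ℝ) × ℝ}
    (hq : GoodCube Ω q) (c : Fin n → Bool) : GoodCube Ω (chd q c) := by
  have h0 := hq.1
  refine ⟨by simp [_root_.chd, h0], fun x hx => ?_⟩
  refine (Metric.ball_subset_ball ?_).trans (hq.2 x (chd_subset h0 c hx))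
  simp only [_root_.chd]
  gcongr
  linarith

theorem volume_cube_ne_top {n : ℕ} {q : (Fin n → ℝ) × ℝ} (hq : 0 < q.2) :
    volume (cube q) ≠ ⊤ := by
  have h1 := volume_cube q hq.le
  intro h
  rw [measureReal_def, h] at h1
  have : 0 < q.2 ^ n := by positivity
  simp at h1
  linarith

theorem mono_w {n : ℕ} {w : EuclideanSpace ℝ (Fin n) → ℝ} (hw0 : ∀ x, 0 < w x)
    {A B : Set (EuclideanSpace ℝ (Fin n))} (hB : IntegrableOn w B) (h : A ⊆ B) :
    ∫ x in A, w x ≤ ∫ x in B, w x :=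
  setIntegral_mono_set hB (ae_of_all _ fun x => (hw0 x).le) (Eventually.of_forall h)

theorem cube_facts {n : ℕ} (hn : 1 ≤ n) {w : EuclideanSpace ℝ (Fin n) → ℝ} (hw0 : ∀ x, 0 < w x)
    {Ω : Set (EuclideanSpace ℝ (Fin n))} {s C : ℝ}
    (hs : 1 < s) (hC : 1 ≤ C)
    (hB : ∀ x ρ, 0 < ρ → Metric.ball x (2 * ρ) ⊆ Ω → RHon w s C (Metric.ball x ρ)) :
    ∃ D C' : ℝ, 0 < D ∧ 1 ≤ C' ∧ ∀ q, GoodCube Ω q → RHon w s C' (cube q) ∧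
      ∀ c, ∫ x in cube q, w x ≤ D * ∫ x in cube (chd q c), w x := by
  have hn' : (1:ℝ) ≤ n := by exact_mod_cast hn
  obtain ⟨D, hD0, hD⟩ := doubling hw0 hs hC hB (κ := 1 / (4 * n)) (by positivity)
    (by rw [div_le_one (by positivity)]; linarith)
  refine ⟨D, max 1 (C * D ^ s), hD0, le_max_left _ _, fun q hq => ?_⟩
  obtain ⟨h0, hq2⟩ := hq
  have hnl : 0 < n * q.2 := by positivity
  have hball : ∀ y ∈ cube q, RHon w s C (Metric.ball y (n * q.2)) := fun y hy =>
    hB y _ hnl (hq2 y hy)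
  have hb := hball _ (ctr_mem h0)
  have hsub := cube_sub_ball hn h0
  have hi := hb.2.2.2.1.mono_set hsub
  have hV : 0 < volume.real (cube q) := by rw [volume_cube q h0.le]; positivity
  refine ⟨⟨measurableSet_cube q, volume_cube_ne_top h0, hV, hi,
    hb.2.2.2.2.1.mono_set hsub, ?_⟩, ?_⟩
  · have h1 := hD _ _ hnl (hq2 _ (ctr_mem h0))
    have h2 : ∫ y in Metric.ball (ctr q) (1 / (4 * ↑n) * (↑n * q.2)), w y ≤
        ∫ y in cube q, w y := by
      refine mono_w hw0 hi ((Metric.ball_subset_ball ?_).trans ball_sub_cube)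
      field_simp
      norm_num
    have hWB := hb.pos hw0
    have hVB := hb.2.2.1
    have hVV : volume.real (cube q) ≤ volume.real (Metric.ball (ctr q) (n * q.2)) :=
      measureReal_mono hsub hb.2.1
    have h3 : ∫ y in cube q, w y ^ s ≤ ∫ y in Metric.ball (ctr q) (n * q.2), w y ^ s :=
      setIntegral_mono_set hb.2.2.2.2.1
        (ae_of_all _ fun x => (Real.rpow_pos_of_pos (hw0 x) _).le) (Eventually.of_forall hsub)
    have h4 := hb.2.2.2.2.2
    set WB := ∫ y in Metric.ball (ctr q) (n * q.2), w y
    set VB := volume.real (Metric.ball (ctr q) (n * q.2))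
    set VQ := volume.real (cube q)
    set WQ := ∫ y in cube q, w y
    have h5 : WB ≤ D * WQ := h1.trans (by gcongr)
    have hWQ : 0 < WQ := by
      by_contra hcon
      push Not at hcon
      nlinarith
    have e : ∀ V W : ℝ, 0 < V → 0 < W → V * (W / V)^s = V ^ (1-s) * W^s := by
      intro V W hV hW
      rw [Real.div_rpow hW.le hV.le, Real.rpow_sub hV, Real.rpow_one]
      field_simp
    calc _ ≤ C * (VB * (WB / VB)^s) := h3.trans h4
      _ = C * (VB ^ (1-s) * WB^s) := by rw [e _ _ hVB hWB]
      _ ≤ C * (VQ ^ (1-s) * (D * WQ)^s) := by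
        have := Real.rpow_le_rpow_of_nonpos hV hVV (show 1 - s ≤ 0 by linarith)
        gcongr
      _ = C * D^s * (VQ ^ (1-s) * WQ^s) := by
        rw [Real.mul_rpow hD0.le hWQ.le]; ring
      _ ≤ max 1 (C * D^s) * (VQ ^ (1-s) * WQ^s) := by
        gcongr
        exact le_max_right _ _
      _ = _ := by rw [e _ _ hV hWQ]
  · intro c
    have hy : ctr (chd q c) ∈ cube q := chd_subset h0 c (ctr_mem (by simp [chd, h0]))
    have h1 := hD _ _ hnl (hq2 _ hy)
    have h2 : ∫ y in Metric.ball (ctr (chd q c)) (1 / (4 * ↑n) * (↑n * q.2)), w y ≤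
        ∫ y in cube (chd q c), w y := by
      refine mono_w hw0 (hi.mono_set (chd_subset h0 c))
        ((Metric.ball_subset_ball ?_).trans ball_sub_cube)
      simp only [chd]
      field_simp
      norm_num
    have h3 := mono_w hw0 (hball _ hy).2.2.2.1 (cube_sub_ball_chd hn h0 c)
    calc _ ≤ _ := h3
      _ ≤ _ := h1
      _ ≤ _ := by gcongr

def PMon {n : ℕ} (w : EuclideanSpace ℝ (Fin n) → ℝ) (p K : ℝ)
    (B : Set (EuclideanSpace ℝ (Fin n))) : Prop :=
  IntegrableOn (fun x => w x ^ p) B ∧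
    ∫ x in B, w x ^ p ≤ K * (volume.real B * ((∫ x in B, w x) / volume.real B) ^ p)

theorem PMon_of_lintegral {n : ℕ} {w : EuclideanSpace ℝ (Fin n) → ℝ} (hw0 : ∀ x, 0 < w x)
    (hwm : Measurable w) {p K : ℝ} (hK : 0 ≤ K) {B : Set (EuclideanSpace ℝ (Fin n))}
    (h : ∫⁻ x in B, ENNReal.ofReal (w x ^ p) ≤
      ENNReal.ofReal (K * (volume.real B * ((∫ x in B, w x) / volume.real B) ^ p))) :
    PMon w p K B := by
  have hm : Measurable fun x => w x ^ p := hwm.pow_const p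
  have hnn : 0 ≤ᵐ[volume.restrict B] fun x => w x ^ p :=
    ae_of_all _ fun x => (Real.rpow_pos_of_pos (hw0 x) _).le
  have hr : 0 ≤ K * (volume.real B * ((∫ x in B, w x) / volume.real B) ^ p) := by
    have : 0 ≤ ∫ x in B, w x := integral_nonneg fun x => (hw0 x).le
    positivity
  constructor
  · refine ⟨hm.aestronglyMeasurable, ?_⟩
    rw [hasFiniteIntegral_iff_ofReal hnn]
    exact h.trans_lt ENNReal.ofReal_lt_top
  · rw [integral_eq_lintegral_of_nonneg_ae hnn hm.aestronglyMeasurable]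
    exact ENNReal.toReal_le_of_le_ofReal hr h

theorem cubes_main {n : ℕ} (hn : 1 ≤ n) {w : EuclideanSpace ℝ (Fin n) → ℝ} (hw0 : ∀ x, 0 < w x)
    (hwm : Measurable w)
    {Ω : Set (EuclideanSpace ℝ (Fin n))} {s C : ℝ}
    (hs : 1 < s) (hC : 1 ≤ C)
    (hB : ∀ x ρ, 0 < ρ → Metric.ball x (2 * ρ) ⊆ Ω → RHon w s C (Metric.ball x ρ)) :
    ∃ t ε K : ℝ, s < t ∧ 0 < ε ∧ 0 ≤ K ∧ ∀ q, GoodCube Ω q → PMon w t K (cube q) ∧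
      PMon w (-ε) K (cube q) := by
  obtain ⟨D, C', hD0, hC', H⟩ := cube_facts hn hw0 hs hC hB
  obtain ⟨α, β, hα0, hα1, hβ, h1⟩ := AI_one hw0 hs hC'
  obtain ⟨β', hβ', h2⟩ := AI_two hw0 hs hC'
  obtain ⟨e1, K1, he1, hK1, hh1⟩ := exists_eps (D := 2^n) (by positivity) hα0 hβ
  obtain ⟨e2, K2, he2, hK2, hh2⟩ := exists_eps hD0 (show (0:ℝ) < 1/3 by norm_num) hβ'
  have one : ∀ S : Set (EuclideanSpace ℝ (Fin n)), ∫ x in S, (1:ℝ) = volume.real S := by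
    intro S; simp
  have i1 : ∀ q : (Fin n → ℝ) × ℝ, GoodCube Ω q → IntegrableOn (fun _ => (1:ℝ)) (cube q) :=
    fun q hq => integrableOn_const (volume_cube_ne_top hq.1)
  have R1 := cube_RH (fun _ => 1) (fun x => w x ^ s) (hwm.pow_const s) (fun _ => one_pos)
    (fun x => Real.rpow_pos_of_pos (hw0 x) s) (GoodCube Ω) (fun q hq c => hq.chd c)
    (fun q hq => hq.1) i1 (fun q hq => (H q hq).1.2.2.2.2.1) (2^n) α β e1 K1 (by positivity)
    (fun q hq c => by
      rw [one, one, volume_cube q hq.1.le, volume_cube _ (hq.chd c).1.le]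
      simp only [chd]
      rw [← mul_pow]
      apply le_of_eq; congr 1; ring) hα0 hα1
    (fun q hq S hS hSm hle => by
      rw [one, one] at hle
      exact h1 _ S (H q hq).1 hS hSm hle) he1 hK1 hh1
  have R2 := cube_RH w (fun _ => 1) measurable_const hw0 (fun _ => one_pos)
    (GoodCube Ω) (fun q hq c => hq.chd c)
    (fun q hq => hq.1) (fun q hq => (H q hq).1.2.2.2.1) i1 D (1/3) β' e2 K2 hD0
    (fun q hq c => (H q hq).2 c) (by norm_num) (by norm_num)
    (fun q hq S hS hSm hle => by
      rw [one, one]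
      exact h2 _ S (H q hq).1 hS hSm hle) he2 hK2 hh2
  have hKK : 0 ≤ max (K1 * C' ^ (1 + e1)) K2 := le_max_of_le_right hK2
  refine ⟨s * (1 + e1), e2, max (K1 * C' ^ (1 + e1)) K2, by nlinarith, he2, hKK,
    fun q hq => ⟨?_, ?_⟩⟩
  · refine PMon_of_lintegral hw0 hwm hKK ?_
    have hr := R1 q hq
    have hq1 := (H q hq).1
    have hW := hq1.pos hw0
    have hV := hq1.2.2.1
    have h6 := hq1.2.2.2.2.2
    have ei : ∀ x, (w x ^ s / 1) ^ e1 * w x ^ s = w x ^ (s * (1 + e1)) := by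
      intro x
      rw [div_one, ← Real.rpow_mul (hw0 x).le, ← Real.rpow_add (hw0 x)]
      congr 1; ring
    simp only [ei, one] at hr
    refine hr.trans (ENNReal.ofReal_le_ofReal ?_)
    set V := volume.real (cube q)
    set W := ∫ x in cube q, w x
    set Y := ∫ x in cube q, w x ^ s
    have hY : 0 ≤ Y := integral_nonneg fun x => (Real.rpow_pos_of_pos (hw0 x) s).le
    calc K1 * (Y * (Y / V)^e1) ≤
        K1 * (C' * (V * (W/V)^s) * ((C' * (V * (W/V)^s)) / V)^e1) := by gcongr
      _ = K1 * C' ^ (1 + e1) * (V * (W/V)^(s * (1 + e1))) := by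
        have : C' * (V * (W/V)^s) / V = C' * (W/V)^s := by field_simp
        rw [this, Real.mul_rpow (by positivity) (by positivity), ← Real.rpow_mul (by positivity),
          mul_add, mul_one, Real.rpow_add (by positivity), Real.rpow_add (by positivity),
          Real.rpow_one]
        ring
      _ ≤ _ := by
        gcongr
        exact le_max_left _ _
  · refine PMon_of_lintegral hw0 hwm hKK ?_
    have hr := R2 q hq
    have hq1 := (H q hq).1
    have hW := hq1.pos hw0
    have hV := hq1.2.2.1
    have ei : ∀ x, (1 / w x) ^ e2 * 1 = w x ^ (-e2) := by
      intro x
      rw [mul_one, one_div, Real.inv_rpow (hw0 x).le, Real.rpow_neg (hw0 x).le]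
    simp only [ei, one] at hr
    refine hr.trans (ENNReal.ofReal_le_ofReal ?_)
    set V := volume.real (cube q)
    set W := ∫ x in cube q, w x
    calc K2 * (V * (V / W)^e2) = K2 * (V * (W/V)^(-e2)) := by
          rw [Real.rpow_neg (by positivity), ← Real.inv_rpow (by positivity), inv_div]
      _ ≤ _ := by
        gcongr
        exact le_max_right _ _

theorem chain_comp {n : ℕ} {w : EuclideanSpace ℝ (Fin n) → ℝ} (hw0 : ∀ x, 0 < w x)
    {Ω : Set (EuclideanSpace ℝ (Fin n))} {s C : ℝ}
    (hs : 1 < s) (hC : 1 ≤ C)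
    (hB : ∀ x ρ, 0 < ρ → Metric.ball x (2 * ρ) ⊆ Ω → RHon w s C (Metric.ball x ρ)) :
    ∃ D : ℝ, 0 < D ∧ ∀ x ρ, 0 < ρ → Metric.ball x (2 * ρ) ⊆ Ω → ∀ z, dist z x ≤ ρ →
      (∫ y in Metric.ball x (ρ/4), w y ≤ D * ∫ y in Metric.ball z (ρ/4), w y) ∧
      (∫ y in Metric.ball z (ρ/4), w y ≤ D * ∫ y in Metric.ball x (ρ/4), w y) := by
  obtain ⟨D, hD0, hD⟩ := doubling hw0 hs hC hB (κ := 1 / 2) (by norm_num) (by norm_num)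
  refine ⟨D^8, by positivity, fun x ρ hρ hx z hz => ?_⟩
  have hgood : ∀ y, dist y x ≤ ρ → Metric.ball y (2 * (ρ/4)) ⊆ Ω := fun y hy =>
    (Metric.ball_subset_ball' (by linarith)).trans hx
  have hop : ∀ y z, dist y x ≤ ρ → dist z x ≤ ρ → dist y z ≤ ρ/8 →
      ∫ y in Metric.ball y (ρ/4), w y ≤ D * ∫ y in Metric.ball z (ρ/4), w y := by
    intro y z hy hz hyz
    refine (hD y (ρ/4) (by positivity) (hgood y hy)).trans ?_
    refine mul_le_mul_of_nonneg_left ?_ hD0.le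
    exact mono_w hw0 (hB z _ (by positivity) (hgood z hz)).2.2.2.1
      (Metric.ball_subset_ball' (by linarith))
  let p : ℕ → EuclideanSpace ℝ (Fin n) := fun j => x + ((j:ℝ)/8) • (z - x)
  have hp1 : ∀ j ≤ 8, dist (p j) x ≤ ρ := by
    intro j hj
    have hj' : (j:ℝ) ≤ 8 := by exact_mod_cast hj
    simp only [p, dist_eq_norm, add_sub_cancel_left, norm_smul, Real.norm_eq_abs]
    rw [← dist_eq_norm, abs_of_nonneg (by positivity)]
    have : (j:ℝ)/8 ≤ 1 := by linarith
    nlinarith [dist_nonneg (x := z) (y := x)]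
  have hp2 : ∀ j, dist (p j) (p (j+1)) ≤ ρ/8 := by
    intro j
    have : p j - p (j+1) = (-(1/8:ℝ)) • (z - x) := by
      simp only [p, add_sub_add_left_eq_sub, ← sub_smul]
      congr 1
      push_cast
      ring
    rw [dist_eq_norm, this, norm_smul, ← dist_eq_norm]
    norm_num
    linarith
  have hch : ∀ j ≤ 8, (∫ y in Metric.ball x (ρ/4), w y ≤ D^j * ∫ y in Metric.ball (p j) (ρ/4), w y) ∧
      (∫ y in Metric.ball (p j) (ρ/4), w y ≤ D^j * ∫ y in Metric.ball x (ρ/4), w y) := by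
    intro j
    induction j with
    | zero => intro _; simp [p]
    | succ j ih =>
      intro hj
      obtain ⟨a, b⟩ := ih (by omega)
      have c := hop (p j) (p (j+1)) (hp1 _ (by omega)) (hp1 _ hj) (hp2 j)
      have d := hop (p (j+1)) (p j) (hp1 _ hj) (hp1 _ (by omega)) (by rw [dist_comm]; exact hp2 j)
      constructor
      · calc _ ≤ _ := a
          _ ≤ D^j * (D * ∫ y in Metric.ball (p (j+1)) (ρ/4), w y) :=
            mul_le_mul_of_nonneg_left c (by positivity)
          _ = _ := by ring
      · calc _ ≤ _ := d
          _ ≤ D * (D^j * ∫ y in Metric.ball x (ρ/4), w y) :=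
            mul_le_mul_of_nonneg_left b (by positivity)
          _ = _ := by ring
  have h8 := hch 8 le_rfl
  have : p 8 = z := by simp [p]
  rwa [this] at h8

theorem rpow_two_sided {m M r p : ℝ} (hm : 0 < m) (h1 : m ≤ r) (h2 : r ≤ M) :
    r ^ p ≤ m ^ p + M ^ p := by
  have hr : 0 < r := by linarith
  have hM : 0 < M := by linarith
  have := Real.rpow_pos_of_pos hm p
  have := Real.rpow_pos_of_pos hM p
  rcases le_total 0 p with hp | hp
  · have := Real.rpow_le_rpow hr.le h2 hp
    linarith
  · have := Real.rpow_le_rpow_of_nonpos hm h1 hp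
    linarith

theorem balls_of_cubes {n : ℕ} (hn : 1 ≤ n) {w : EuclideanSpace ℝ (Fin n) → ℝ}
    (hw0 : ∀ x, 0 < w x)
    {Ω : Set (EuclideanSpace ℝ (Fin n))} {s C : ℝ}
    (hs : 1 < s) (hC : 1 ≤ C)
    (hB : ∀ x ρ, 0 < ρ → Metric.ball x (2 * ρ) ⊆ Ω → RHon w s C (Metric.ball x ρ))
    {p K : ℝ} (hK : 0 ≤ K) (hQ : ∀ q, GoodCube Ω q → PMon w p K (cube q)) :
    ∃ K' : ℝ, 0 ≤ K' ∧ ∀ x ρ, 0 < ρ → Metric.ball x (2 * ρ) ⊆ Ω →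
      PMon w p K' (Metric.ball x ρ) := by
  have hn' : (1:ℝ) ≤ n := by exact_mod_cast hn
  obtain ⟨D1, hD1, H1⟩ := chain_comp hw0 hs hC hB
  obtain ⟨D2, hD2, H2⟩ := doubling hw0 hs hC hB (κ := 1 / 4) (by norm_num) (by norm_num)
  obtain ⟨D3, hD3, H3⟩ := doubling hw0 hs hC hB (κ := 1 / (2 * n)) (by positivity)
    (by rw [div_le_one (by positivity)]; linarith)
  set η : ℝ := 1 / (4 * n) with hη
  have hη0 : 0 < η := by positivity
  have hnη : n * η = 1/4 := by rw [hη]; field_simp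
  obtain ⟨F, hF1, hF2, hF3⟩ := (isCompact_closedBall (0 : EuclideanSpace ℝ (Fin n)) 1).finite_cover_balls
    (show 0 < η / 2 by positivity)
  lift F to Finset (EuclideanSpace ℝ (Fin n)) using hF2
  set ω := volume.real (Metric.ball (0 : EuclideanSpace ℝ (Fin n)) 1) with hω
  have hω0 : 0 < ω := by
    rw [hω, measureReal_def]
    exact ENNReal.toReal_pos (Metric.measure_ball_pos _ _ one_pos).ne' measure_ball_lt_top.ne
  set γ := η ^ n / ω with hγ
  have hγ0 : 0 < γ := by positivity
  set m := (D3 * D1 * D2)⁻¹ / γ with hm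
  set M := D1 / γ with hM
  have hm0 : 0 < m := by positivity
  have hM0 : 0 < M := by positivity
  refine ⟨F.card * (K * (γ * (m ^ p + M ^ p))), by positivity, fun x ρ hρ hx => ?_⟩
  let Q : EuclideanSpace ℝ (Fin n) → (Fin n → ℝ) × ℝ := fun z =>
    (fun i => (x + ρ • z) i - η * ρ / 2, η * ρ)
  have hctr : ∀ z, ctr (Q z) = x + ρ • z := by
    intro z
    ext i
    simp [ctr, Q]
  have hside : ∀ z, (Q z).2 = η * ρ := fun z => rfl
  have hs0 : ∀ z, 0 < (Q z).2 := fun z => by rw [hside]; positivity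
  have hnh : n * (η * ρ) = ρ / 4 := by rw [← mul_assoc, hnη]; ring
  have hqb : ∀ z, cube (Q z) ⊆ Metric.ball (x + ρ • z) (ρ / 4) := by
    intro z
    have := cube_sub_ball hn (hs0 z)
    rwa [hctr, hside, hnh] at this
  have hdz : ∀ z ∈ F, dist (x + ρ • z) x ≤ ρ := by
    intro z hz
    have h1 := hF1 hz
    rw [mem_closedBall_zero_iff] at h1
    rw [dist_eq_norm, add_sub_cancel_left, norm_smul, Real.norm_eq_abs, abs_of_pos hρ]
    nlinarith
  have hgood : ∀ z ∈ F, GoodCube Ω (Q z) := by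
    intro z hz
    refine ⟨hs0 z, fun y hy => ?_⟩
    have h1 := hqb z hy
    rw [Metric.mem_ball] at h1
    have h2 := hdz z hz
    have h3 := dist_triangle y (x + ρ • z) x
    refine (Metric.ball_subset_ball' ?_).trans hx
    rw [hside, hnh]
    linarith
  have hcov : Metric.ball x ρ ⊆ ⋃ z ∈ F, cube (Q z) := by
    intro y hy
    rw [Metric.mem_ball, dist_eq_norm] at hy
    have h1 : ρ⁻¹ • (y - x) ∈ Metric.closedBall (0 : EuclideanSpace ℝ (Fin n)) 1 := by
      rw [mem_closedBall_zero_iff, norm_smul, norm_inv, Real.norm_eq_abs, abs_of_pos hρ,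
        inv_mul_le_iff₀ hρ]
      linarith
    have h2 := hF3 h1
    simp only [Set.mem_iUnion, exists_prop] at h2 ⊢
    obtain ⟨z, hz, h3⟩ := h2
    refine ⟨z, hz, ball_sub_cube ?_⟩
    rw [hctr, hside, Metric.mem_ball, dist_eq_norm]
    rw [Metric.mem_ball, dist_eq_norm] at h3
    have h4 : y - (x + ρ • z) = ρ • (ρ⁻¹ • (y - x) - z) := by
      rw [smul_sub, smul_inv_smul₀ hρ.ne']
      abel
    rw [h4, norm_smul, Real.norm_eq_abs, abs_of_pos hρ]
    nlinarith
  have hVB : volume.real (Metric.ball x ρ) = ρ ^ n * ω := by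
    have := vol_ball_mul x hρ 1
    rw [mul_one] at this
    rw [this, Measure.addHaar_real_ball_center]
  have hb := hB x ρ hρ hx
  have hWB := hb.pos hw0
  have hVB0 := hb.2.2.1
  set WB := ∫ y in Metric.ball x ρ, w y with hWBd
  set VB := volume.real (Metric.ball x ρ) with hVBd
  have hVQ : ∀ z, volume.real (cube (Q z)) = γ * VB := by
    intro z
    rw [volume_cube _ (hs0 z).le, hside, hVB, hγ, mul_pow]
    field_simp
  have hest : ∀ z ∈ F, ∫ y in cube (Q z), w y ^ p ≤
      K * (γ * (m ^ p + M ^ p)) * (VB * (WB / VB) ^ p) := by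
    intro z hz
    have h1 := (hQ _ (hgood z hz)).2
    have hzgood : Metric.ball (x + ρ • z) (2 * (ρ/4)) ⊆ Ω :=
      (Metric.ball_subset_ball' (by linarith [hdz z hz])).trans hx
    have hzi := (hB _ (ρ/4) (by positivity) hzgood).2.2.2.1
    obtain ⟨c1, c2⟩ := H1 x ρ hρ hx _ (hdz z hz)
    have c3 := H2 x ρ hρ hx
    rw [show 1/4 * ρ = ρ/4 by ring] at c3
    have c4 := H3 (x + ρ • z) (ρ/4) (by positivity) hzgood
    have c5 : ∫ y in Metric.ball (x + ρ • z) (1 / (2 * ↑n) * (ρ / 4)), w y ≤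
        ∫ y in cube (Q z), w y := by
      refine mono_w hw0 (hzi.mono_set (hqb z)) ?_
      have := ball_sub_cube (q := Q z)
      rw [hctr, hside] at this
      refine (Metric.ball_subset_ball ?_).trans this
      rw [hη]
      apply le_of_eq
      field_simp
    have c6 := mono_w hw0 hzi (hqb z)
    have c7 : ∫ y in Metric.ball x (ρ/4), w y ≤ WB :=
      mono_w hw0 hb.2.2.2.1 (Metric.ball_subset_ball (by linarith))
    rw [hVQ] at h1
    set WQ := ∫ y in cube (Q z), w y
    have u1 : WQ ≤ D1 * WB := by
      calc WQ ≤ _ := c6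
        _ ≤ _ := c2
        _ ≤ _ := mul_le_mul_of_nonneg_left c7 hD1.le
    have u2 : WB ≤ D3 * D1 * D2 * WQ := by
      calc WB ≤ _ := c3
        _ ≤ D2 * (D1 * (D3 * WQ)) := by
          refine mul_le_mul_of_nonneg_left (c1.trans ?_) hD2.le
          refine mul_le_mul_of_nonneg_left (c4.trans ?_) hD1.le
          exact mul_le_mul_of_nonneg_left c5 hD3.le
        _ = _ := by ring
    set r := (WQ / WB) / γ with hr
    have r1 : m ≤ r := by
      rw [hm, hr]
      gcongr
      rw [le_div_iff₀ hWB, inv_mul_le_iff₀ (by positivity)]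
      exact u2
    have r2 : r ≤ M := by
      rw [hM, hr]
      gcongr
      rw [div_le_iff₀ hWB]
      exact u1
    have r3 : WQ / (γ * VB) = r * (WB / VB) := by
      rw [hr]; field_simp
    have r0 : 0 < r := by linarith
    calc _ ≤ K * (γ * VB * (r * (WB / VB))^p) := by rw [← r3]; exact h1
      _ = K * (γ * r^p) * (VB * (WB / VB)^p) := by
        rw [Real.mul_rpow r0.le (by positivity)]; ring
      _ ≤ _ := by
        gcongr
        exact rpow_two_sided hm0 r1 r2
  have hint : IntegrableOn (fun y => w y ^ p) (⋃ z ∈ F, cube (Q z)) := by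
    rw [integrableOn_finset_iUnion]
    exact fun z hz => (hQ _ (hgood z hz)).1
  have hnn : ∀ y, 0 ≤ w y ^ p := fun y => (Real.rpow_pos_of_pos (hw0 y) _).le
  refine ⟨hint.mono_set hcov, ?_⟩
  calc ∫ y in Metric.ball x ρ, w y ^ p ≤ ∫ y in ⋃ z ∈ F, cube (Q z), w y ^ p :=
        setIntegral_mono_set hint (ae_of_all _ hnn) (Eventually.of_forall hcov)
    _ ≤ ∑ z ∈ F, ∫ y in cube (Q z), w y ^ p := by
        have hsum : ∀ F' : Finset (EuclideanSpace ℝ (Fin n)), F' ⊆ F →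
            ∫ y in ⋃ z ∈ F', cube (Q z), w y ^ p ≤ ∑ z ∈ F', ∫ y in cube (Q z), w y ^ p := by
          intro F'
          classical
          induction F' using Finset.induction_on with
          | empty => simp
          | insert z F' hz ih =>
            intro hsub
            rw [Finset.sum_insert hz, Finset.set_biUnion_insert]
            have hzF : z ∈ F := hsub (Finset.mem_insert_self _ _)
            have hF'F : F' ⊆ F := fun y hy => hsub (Finset.mem_insert_of_mem hy)
            have ia := (hQ _ (hgood z hzF)).1
            have ib : IntegrableOn (fun y => w y ^ p) (⋃ z ∈ F', cube (Q z)) :=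
              hint.mono_set (Set.biUnion_subset_biUnion_left hF'F)
            have hmeas : MeasurableSet (⋃ z ∈ F', cube (Q z)) :=
              Finset.measurableSet_biUnion _ fun z _ => measurableSet_cube _
            rw [← Set.union_sdiff_self, setIntegral_union Set.disjoint_sdiff_right
              (hmeas.diff (measurableSet_cube _)) ia (ib.mono_set Set.sdiff_subset)]
            have : ∫ y in (⋃ z ∈ F', cube (Q z)) \ cube (Q z), w y ^ p ≤
                ∫ y in ⋃ z ∈ F', cube (Q z), w y ^ p := setIntegral_mono_set ib (ae_of_all _ hnn)
              (Eventually.of_forall (Set.sdiff_subset (s := ⋃ z ∈ F', cube (Q z)) (t := cube (Q z))))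
            linarith [ih hF'F]
        exact hsum F subset_rfl
    _ ≤ ∑ _z ∈ F, K * (γ * (m ^ p + M ^ p)) * (VB * (WB / VB) ^ p) := Finset.sum_le_sum hest
    _ = _ := by
        rw [Finset.sum_const, nsmul_eq_mul]; ring

theorem meanFinite_coe {n : ℕ} (w : EuclideanSpace ℝ (Fin n) → ℝ) {p : ℝ} (hp : p ≠ 0)
    (B : Set (EuclideanSpace ℝ (Fin n))) :
    MeanFinite w (p : EReal) B ↔ IntegrableOn (fun x => (w x) ^ p) B := by
  simp [MeanFinite, hp]

theorem pMean_coe {n : ℕ} (w : EuclideanSpace ℝ (Fin n) → ℝ) {p : ℝ} (hp : p ≠ 0)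
    (B : Set (EuclideanSpace ℝ (Fin n))) :
    pMean w (p : EReal) B = (⨍ x in B, (w x) ^ p) ^ (1 / p) := by
  simp [pMean, hp]

theorem meanFinite_zero {n : ℕ} (w : EuclideanSpace ℝ (Fin n) → ℝ)
    (B : Set (EuclideanSpace ℝ (Fin n))) :
    MeanFinite w 0 B ↔ IntegrableOn (fun x => Real.log (w x)) B := by
  simp [MeanFinite]

theorem pMean_zero {n : ℕ} (w : EuclideanSpace ℝ (Fin n) → ℝ)
    (B : Set (EuclideanSpace ℝ (Fin n))) :
    pMean w 0 B = Real.exp (⨍ x in B, Real.log (w x)) := by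
  simp [pMean]

theorem meanFinite_one {n : ℕ} (w : EuclideanSpace ℝ (Fin n) → ℝ)
    (B : Set (EuclideanSpace ℝ (Fin n))) :
    MeanFinite w 1 B ↔ IntegrableOn w B := by
  have := meanFinite_coe w (p := 1) one_ne_zero B
  simpa using this

theorem pMean_one {n : ℕ} (w : EuclideanSpace ℝ (Fin n) → ℝ)
    (B : Set (EuclideanSpace ℝ (Fin n))) :
    pMean w 1 B = ⨍ x in B, w x := by
  have := pMean_coe w (p := 1) one_ne_zero B
  simpa using this

theorem average_eq_div {n : ℕ} (f : EuclideanSpace ℝ (Fin n) → ℝ)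
    (B : Set (EuclideanSpace ℝ (Fin n))) :
    ⨍ x in B, f x = (∫ x in B, f x) / volume.real B := by
  rw [setAverage_eq, smul_eq_mul]; ring

theorem mean_congr {n : ℕ} {w w' : EuclideanSpace ℝ (Fin n) → ℝ}
    {B : Set (EuclideanSpace ℝ (Fin n))} (h : w =ᵐ[volume.restrict B] w') (p : ℝ) :
    (MeanFinite w (p : EReal) B ↔ MeanFinite w' (p : EReal) B) ∧
      pMean w (p : EReal) B = pMean w' (p : EReal) B := by
  by_cases hp : p = 0
  · subst hp
    have h1 : (fun x => Real.log (w x)) =ᵐ[volume.restrict B] fun x => Real.log (w' x) := by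
      filter_upwards [h] with x hx; rw [hx]
    rw [EReal.coe_zero, meanFinite_zero, meanFinite_zero, pMean_zero, pMean_zero]
    exact ⟨integrable_congr h1, by rw [average_congr h1]⟩
  · have h1 : (fun x => (w x) ^ p) =ᵐ[volume.restrict B] fun x => (w' x) ^ p := by
      filter_upwards [h] with x hx; rw [hx]
    rw [meanFinite_coe _ hp, meanFinite_coe _ hp, pMean_coe _ hp, pMean_coe _ hp]
    exact ⟨integrable_congr h1, by rw [average_congr h1]⟩

theorem memRC_congr {n : ℕ} {w w' : EuclideanSpace ℝ (Fin n) → ℝ}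
    {Ω : Set (EuclideanSpace ℝ (Fin n))} (h : ∀ᵐ x, x ∈ Ω → w x = w' x) (p r C : ℝ)
    (hw : MemRC Ω w (p : EReal) (r : EReal) C) : MemRC Ω w' (p : EReal) (r : EReal) C := by
  intro B hB
  have hBm : MeasurableSet B := by
    obtain ⟨x, ρ, _, rfl, _⟩ := hB
    exact measurableSet_ball
  have hBΩ : B ⊆ Ω := by
    obtain ⟨x, ρ, hρ, rfl, h2⟩ := hB
    exact (Metric.ball_subset_ball (by linarith)).trans h2
  have hae : w =ᵐ[volume.restrict B] w' := by
    refine (ae_restrict_iff' hBm).2 ?_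
    filter_upwards [h] with x hx hxB using hx (hBΩ hxB)
  obtain ⟨a1, a2⟩ := mean_congr hae p
  obtain ⟨b1, b2⟩ := mean_congr hae r
  rw [← a1, ← b1, ← a2, ← b2]
  exact hw B hB

theorem inRC_congr {n : ℕ} {w w' : EuclideanSpace ℝ (Fin n) → ℝ}
    {Ω : Set (EuclideanSpace ℝ (Fin n))} (h : ∀ᵐ x, x ∈ Ω → w x = w' x) (p r : ℝ)
    (hw : InRC Ω w (p : EReal) (r : EReal)) : InRC Ω w' (p : EReal) (r : EReal) := by
  obtain ⟨C, hC, hw⟩ := hw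
  exact ⟨C, hC, memRC_congr h p r C hw⟩

theorem geom_lower {n : ℕ} {w : EuclideanSpace ℝ (Fin n) → ℝ} (hw0 : ∀ x, 0 < w x)
    (hwm : Measurable w) {B : Set (EuclideanSpace ℝ (Fin n))} (hBt : volume B ≠ ⊤)
    (hV : 0 < volume.real B) (hi : IntegrableOn w B) (hW : 0 < ∫ x in B, w x)
    {ε K : ℝ} (hε : 0 < ε) (hK : 0 ≤ K) (hP : PMon w (-ε) K B) :
    IntegrableOn (fun x => Real.log (w x)) B ∧
      (∫ x in B, w x) / volume.real B ≤ K ^ (1/ε) * Real.exp (⨍ x in B, Real.log (w x)) := by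
  have hlog : IntegrableOn (fun x => Real.log (w x)) B := by
    refine Integrable.mono' (hi.add (hP.1.const_mul (1/ε)))
      (Real.measurable_log.comp hwm).aestronglyMeasurable (ae_of_all _ fun x => ?_)
    have p1 := hw0 x
    have p2 := Real.rpow_pos_of_pos p1 (-ε)
    have h1 := Real.log_le_sub_one_of_pos p1
    have h2 := Real.log_le_sub_one_of_pos p2
    rw [Real.log_rpow p1] at h2
    have h3 : -Real.log (w x) ≤ 1/ε * w x ^ (-ε) := by
      rw [div_mul_eq_mul_div, le_div_iff₀ hε]
      linarith
    have h4 : 0 < 1/ε * w x ^ (-ε) := by positivity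
    simp only [Pi.add_apply, Real.norm_eq_abs, abs_le]
    constructor <;> linarith
  refine ⟨hlog, ?_⟩
  set a := ⨍ x in B, Real.log (w x) with ha
  have ha' : ∫ x in B, Real.log (w x) = a * volume.real B := by
    rw [ha, average_eq_div]; field_simp
  have i0 : IntegrableOn (fun _ : EuclideanSpace ℝ (Fin n) => 1 + ε * a) B := integrableOn_const hBt
  have hJ : volume.real B ≤ Real.exp (ε * a) * ∫ x in B, w x ^ (-ε) := by
    calc volume.real B = ∫ x in B, ((1 + ε * a) - ε * Real.log (w x)) := by
          rw [integral_sub i0 (hlog.const_mul ε), integral_const_mul, ha']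
          simp
          ring
      _ ≤ ∫ x in B, Real.exp (ε * a) * w x ^ (-ε) := by
          refine integral_mono (i0.sub (hlog.const_mul ε)) (hP.1.const_mul _) fun x => ?_
          have : Real.exp (ε * a) * w x ^ (-ε) = Real.exp (ε * a - ε * Real.log (w x)) := by
            rw [Real.rpow_def_of_pos (hw0 x), ← Real.exp_add]
            congr 1; ring
          simp only [this]
          have := Real.add_one_le_exp (ε * a - ε * Real.log (w x))
          linarith
      _ = _ := integral_const_mul _ _
  have h2 := hP.2
  set V := volume.real B
  set A := (∫ x in B, w x) / V with hA
  have hA0 : 0 < A := by positivity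
  have h3 : A ^ ε ≤ K * Real.exp (ε * a) := by
    have h4 : V ≤ Real.exp (ε * a) * (K * (V * A ^ (-ε))) :=
      hJ.trans (mul_le_mul_of_nonneg_left h2 (Real.exp_pos _).le)
    have h5 : V * 1 ≤ V * (Real.exp (ε * a) * K * A ^ (-ε)) := by linarith
    have h6 := le_of_mul_le_mul_left h5 hV
    rw [Real.rpow_neg hA0.le, ← div_eq_mul_inv, le_div_iff₀ (by positivity)] at h6
    linarith
  calc A = (A ^ ε) ^ (1/ε) := by
        rw [← Real.rpow_mul hA0.le, mul_one_div_cancel hε.ne', Real.rpow_one]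
    _ ≤ (K * Real.exp (ε * a)) ^ (1/ε) := by gcongr
    _ = _ := by
        rw [Real.mul_rpow hK (Real.exp_pos _).le, ← Real.exp_mul]
        congr 2
        field_simp

theorem rhs_positive {n : ℕ} (hn : 1 ≤ n)
    {Ω : Set (EuclideanSpace ℝ (Fin n))}
    {w : EuclideanSpace ℝ (Fin n) → ℝ} (hwm : Measurable w) (hw0 : ∀ x, 0 < w x)
    {s : ℝ} (hs : 1 < s) (h : InRC Ω w 1 ((s : ℝ) : EReal)) :
    ∃ t : ℝ, s < t ∧ InRC Ω w 0 ((t : ℝ) : EReal) ∧ InRC Ω w 1 ((t : ℝ) : EReal) := by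
  obtain ⟨C, hC, h⟩ := h
  have hB : ∀ x ρ, 0 < ρ → Metric.ball x (2 * ρ) ⊆ Ω → RHon w s (C^s) (Metric.ball x ρ) := by
    intro x ρ hρ hx
    obtain ⟨h1, h2, h3⟩ := h _ ⟨x, ρ, hρ, rfl, hx⟩
    rw [meanFinite_one] at h1
    rw [meanFinite_coe w (by linarith)] at h2
    rw [pMean_one, pMean_coe w (by linarith), average_eq_div, average_eq_div] at h3
    have hV : 0 < volume.real (Metric.ball x ρ) := by
      rw [measureReal_def]
      exact ENNReal.toReal_pos (Metric.measure_ball_pos _ _ hρ).ne' measure_ball_lt_top.ne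
    refine ⟨measurableSet_ball, measure_ball_lt_top.ne, hV, h1, h2, ?_⟩
    have hW : 0 ≤ ∫ y in Metric.ball x ρ, w y := integral_nonneg fun x => (hw0 x).le
    have hY : 0 ≤ ∫ y in Metric.ball x ρ, w y ^ s :=
      integral_nonneg fun x => (Real.rpow_pos_of_pos (hw0 x) s).le
    set V := volume.real (Metric.ball x ρ)
    set W := ∫ y in Metric.ball x ρ, w y
    set Y := ∫ y in Metric.ball x ρ, w y ^ s
    have h4 := Real.rpow_le_rpow (by positivity) h3 (show 0 ≤ s by linarith)
    rw [← Real.rpow_mul (by positivity), one_div_mul_cancel (by linarith), Real.rpow_one,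
      Real.mul_rpow (by linarith) (by positivity), div_le_iff₀ hV] at h4
    linarith
  have hCs : 1 ≤ C^s := Real.one_le_rpow hC (by linarith)
  obtain ⟨t, ε, K, ht, hε, hK, hQ⟩ := cubes_main hn hw0 hwm hs hCs hB
  obtain ⟨K1, hK1, H1⟩ := balls_of_cubes hn hw0 hs hCs hB hK fun q hq => (hQ q hq).1
  obtain ⟨K2, hK2, H2⟩ := balls_of_cubes hn hw0 hs hCs hB hK fun q hq => (hQ q hq).2
  have ht0 : 0 < t := by linarith
  have main : ∀ B ∈ ballsIn Ω, MeanFinite w 1 B ∧ MeanFinite w (t : EReal) B ∧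
      pMean w (t : EReal) B ≤ K1 ^ (1/t) * pMean w 1 B ∧ MeanFinite w 0 B ∧
      pMean w 1 B ≤ K2 ^ (1/ε) * pMean w 0 B ∧ 0 ≤ pMean w 1 B := by
    rintro B ⟨x, ρ, hρ, rfl, hx⟩
    have hb := hB x ρ hρ hx
    have hW := hb.pos hw0
    obtain ⟨-, hBt, hV, hi, -, -⟩ := hb
    have g := geom_lower hw0 hwm hBt hV hi hW hε hK2 (H2 x ρ hρ hx)
    have p := H1 x ρ hρ hx
    rw [meanFinite_one, meanFinite_coe w ht0.ne', meanFinite_zero, pMean_one,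
      pMean_coe w ht0.ne', pMean_zero, average_eq_div w, average_eq_div (fun x => w x ^ t)]
    refine ⟨hi, p.1, ?_, g.1, g.2, by positivity⟩
    have hY : 0 ≤ ∫ y in Metric.ball x ρ, w y ^ t :=
      integral_nonneg fun x => (Real.rpow_pos_of_pos (hw0 x) t).le
    have p2 := p.2
    set V := volume.real (Metric.ball x ρ)
    set W := ∫ y in Metric.ball x ρ, w y
    set Y := ∫ y in Metric.ball x ρ, w y ^ t
    have h1 : Y / V ≤ K1 * (W / V) ^ t := by
      rw [div_le_iff₀ hV]; linarith
    calc (Y / V) ^ (1/t) ≤ (K1 * (W / V) ^ t) ^ (1/t) := by gcongr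
      _ = _ := by
        rw [Real.mul_rpow hK1 (by positivity), ← Real.rpow_mul (by positivity),
          mul_one_div_cancel ht0.ne', Real.rpow_one]
  refine ⟨t, ht, ⟨max 1 (K1 ^ (1/t) * K2 ^ (1/ε)), le_max_left _ _, fun B hB' => ?_⟩,
    ⟨max 1 (K1 ^ (1/t)), le_max_left _ _, fun B hB' => ?_⟩⟩
  · obtain ⟨m1, m2, m3, m4, m5, m6⟩ := main B hB'
    refine ⟨m4, m2, ?_⟩
    have m7 : 0 ≤ pMean w 0 B := by rw [pMean_zero]; positivity
    calc _ ≤ _ := m3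
      _ ≤ K1 ^ (1/t) * (K2 ^ (1/ε) * pMean w 0 B) := by gcongr
      _ = K1 ^ (1/t) * K2 ^ (1/ε) * pMean w 0 B := by ring
      _ ≤ _ := by gcongr; exact le_max_right _ _
  · obtain ⟨m1, m2, m3, m4, m5, m6⟩ := main B hB'
    refine ⟨m1, m2, m3.trans ?_⟩
    gcongr
    exact le_max_right _ _

end Helpers

/-- **Corollary 5.4.** For `1 < s < ∞`: if `w ∈ RH_s`, then there exists `t > s` such that
`w ∈ RC(0,t)`; in particular `w ∈ RH_t = RC(1,t)`. -/
theorem rhs_selfimproves {n : ℕ} (hn : 1 ≤ n)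
    {Ω : Set (EuclideanSpace ℝ (Fin n))} (hΩ : IsOpen Ω)
    {w : EuclideanSpace ℝ (Fin n) → ℝ} (hw : IsWeight Ω w)
    {s : ℝ} (hs : 1 < s) (h : InRC Ω w 1 ((s : ℝ) : EReal)) :
    ∃ t : ℝ, s < t ∧ InRC Ω w 0 ((t : ℝ) : EReal) ∧ InRC Ω w 1 ((t : ℝ) : EReal) := by
  classical
  obtain ⟨hwm, hpos⟩ := hw
  let w' : EuclideanSpace ℝ (Fin n) → ℝ := fun x => if 0 < w x then w x else 1
  have hw'm : Measurable w' :=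
    Measurable.ite (measurableSet_lt measurable_const hwm) hwm measurable_const
  have hw'0 : ∀ x, 0 < w' x := by
    intro x
    simp only [w']
    split_ifs with hx
    · exact hx
    · exact one_pos
  have hae : ∀ᵐ x, x ∈ Ω → w x = w' x := by
    filter_upwards [hpos] with x hx hxΩ
    simp [w', hx hxΩ]
  have hae' : ∀ᵐ x, x ∈ Ω → w' x = w x := by
    filter_upwards [hae] with x hx hxΩ using (hx hxΩ).symm
  obtain ⟨t, ht, h0, h1⟩ := rhs_positive hn hw'm hw'0 hs
    (by simpa using inRC_congr hae 1 s (by simpa using h))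
  exact ⟨t, ht, by simpa using inRC_congr hae' 0 t (by simpa using h0),
    by simpa using inRC_congr hae' 1 t (by simpa using h1)⟩
end

section
/- (Theorem 7.1, interpolation of reverse classes.) Let r₁ ≤ r₂ < 0 < s₁ ≤ s₂ be real numbers, C₁, C₂ ≥ 1, and let u ∈ RC(r₁, s₁, C₁) and v ∈ RC(r₂, s₂, C₂). Then for every θ ∈ [0,1], the weight u^θ v^{1−θ} belongs to RC(r_θ, s_θ, C₁^θ C₂^{1−θ}), where the exponents r_θ < 0 < s_θ are defined by 1/r_θ = θ/r₁ + (1−θ)/r₂ and 1/s_θ = θ/s₁ + (1−θ)/s₂. -/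
open MeasureTheory

theorem rc_holder_aux {X : Type*} [MeasurableSpace X] {μ : Measure X} [IsProbabilityMeasure μ]
    {F G : X → ℝ} (hF : Integrable F μ) (hG : Integrable G μ)
    (hF0 : ∀ᵐ x ∂μ, 0 < F x) (hG0 : ∀ᵐ x ∂μ, 0 < G x)
    {a b : ℝ} (ha : 0 ≤ a) (hb : 0 ≤ b) (hab : a + b = 1) :
    0 < ∫ x, F x ∂μ ∧ 0 < ∫ x, G x ∂μ ∧ Integrable (fun x => F x ^ a * G x ^ b) μ ∧
    0 < ∫ x, F x ^ a * G x ^ b ∂μ ∧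
    ∫ x, F x ^ a * G x ^ b ∂μ ≤ (∫ x, F x ∂μ) ^ a * (∫ x, G x ∂μ) ^ b := by
  have pos : ∀ H : X → ℝ, Integrable H μ → (∀ᵐ x ∂μ, 0 < H x) → 0 < ∫ x, H x ∂μ := by
    intro H hH h0
    have h1 : 0 ≤ᵐ[μ] H := h0.mono fun x hx => hx.le
    refine (integral_nonneg_of_ae h1).lt_of_ne fun h => ?_
    have h2 := (integral_eq_zero_iff_of_nonneg_ae h1 hH).1 h.symm
    have h3 : ∀ᵐ x ∂μ, False := by
      filter_upwards [h0, h2] with x hx hx2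
      simp at hx2
      linarith
    have h4 := h3.exists
    simp at h4
  have hA := pos F hF hF0
  have hB := pos G hG hG0
  set A := ∫ x, F x ∂μ with hAd
  set B := ∫ x, G x ∂μ with hBd
  have hle : ∀ᵐ x ∂μ, F x ^ a * G x ^ b ≤ (A ^ a * B ^ b) * (a * (F x / A) + b * (G x / B)) := by
    filter_upwards [hF0, hG0] with x hx hy
    have h := Real.geom_mean_le_arith_mean2_weighted ha hb (div_pos hx hA).le (div_pos hy hB).le hab
    rw [Real.div_rpow hx.le hA.le, Real.div_rpow hy.le hB.le] at h
    have hAa := Real.rpow_pos_of_pos hA a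
    have hBb := Real.rpow_pos_of_pos hB b
    calc F x ^ a * G x ^ b = (A ^ a * B ^ b) * (F x ^ a / A ^ a * (G x ^ b / B ^ b)) := by
          field_simp
      _ ≤ _ := by gcongr
  have hint : Integrable (fun x => (A ^ a * B ^ b) * (a * (F x / A) + b * (G x / B))) μ :=
    (((hF.div_const A).const_mul a).add ((hG.div_const B).const_mul b)).const_mul _
  have hI : Integrable (fun x => F x ^ a * G x ^ b) μ := by
    refine hint.mono' ?_ ?_
    · exact ((hF.aemeasurable.pow_const a).mul (hG.aemeasurable.pow_const b)).aestronglyMeasurable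
    · filter_upwards [hle, hF0, hG0] with x h hx hy
      rwa [Real.norm_of_nonneg (by positivity)]
  refine ⟨hA, hB, hI, pos _ hI ?_, ?_⟩
  · filter_upwards [hF0, hG0] with x hx hy
    positivity
  · refine (integral_mono_ae hI hint hle).trans_eq ?_
    rw [integral_const_mul, integral_add ((hF.div_const A).const_mul a) ((hG.div_const B).const_mul b),
      integral_const_mul, integral_const_mul, integral_div, integral_div, ← hAd, ← hBd,
      div_self hA.ne', div_self hB.ne', mul_one, mul_one, hab, mul_one]

theorem rc_mean_aux {X : Type*} [MeasurableSpace X] {μ : Measure X} [IsProbabilityMeasure μ]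
    {u v : X → ℝ} (hu0 : ∀ᵐ x ∂μ, 0 < u x) (hv0 : ∀ᵐ x ∂μ, 0 < v x)
    {p q t θ : ℝ} (hp : p ≠ 0) (hq : q ≠ 0) (ht : t ≠ 0)
    (hu : Integrable (fun x => u x ^ p) μ) (hv : Integrable (fun x => v x ^ q) μ)
    (ha : 0 ≤ θ * t / p) (hb : 0 ≤ (1 - θ) * t / q)
    (h : 1 / t = θ / p + (1 - θ) / q) :
    0 < ∫ x, u x ^ p ∂μ ∧ 0 < ∫ x, v x ^ q ∂μ ∧
    Integrable (fun x => (u x ^ θ * v x ^ (1 - θ)) ^ t) μ ∧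
    0 < ∫ x, (u x ^ θ * v x ^ (1 - θ)) ^ t ∂μ ∧
    ∫ x, (u x ^ θ * v x ^ (1 - θ)) ^ t ∂μ ≤
      (∫ x, u x ^ p ∂μ) ^ (θ * t / p) * (∫ x, v x ^ q ∂μ) ^ ((1 - θ) * t / q) := by
  have hab : θ * t / p + (1 - θ) * t / q = 1 := by
    have : θ * t / p + (1 - θ) * t / q = t * (θ / p + (1 - θ) / q) := by ring
    rw [this, ← h]; field_simp
  have key := rc_holder_aux hu hv (hu0.mono fun x hx => Real.rpow_pos_of_pos hx p)
    (hv0.mono fun x hx => Real.rpow_pos_of_pos hx q) ha hb hab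
  have he : (fun x => (u x ^ p) ^ (θ * t / p) * (v x ^ q) ^ ((1 - θ) * t / q)) =ᵐ[μ]
      fun x => (u x ^ θ * v x ^ (1 - θ)) ^ t := by
    filter_upwards [hu0, hv0] with x hx hy
    rw [Real.mul_rpow (by positivity) (by positivity), ← Real.rpow_mul hx.le, ← Real.rpow_mul hx.le,
      ← Real.rpow_mul hy.le, ← Real.rpow_mul hy.le, mul_div_cancel₀ _ hp, mul_div_cancel₀ _ hq]
  rw [integral_congr_ae he, integrable_congr he] at key
  exact key

/-- **Theorem 7.1 (interpolation of reverse classes).** Let `r₁ ≤ r₂ < 0 < s₁ ≤ s₂`,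
`u ∈ RC(r₁,s₁,C₁)`, `v ∈ RC(r₂,s₂,C₂)`. Then for every `θ ∈ [0,1]` the weight
`u^θ v^{1−θ}` belongs to `RC(r_θ, s_θ, C₁^θ C₂^{1−θ})`, where `r_θ < 0 < s_θ` are defined by
`1/r_θ = θ/r₁ + (1−θ)/r₂` and `1/s_θ = θ/s₁ + (1−θ)/s₂`. -/
theorem rc_interpolation {n : ℕ} (hn : 1 ≤ n)
    {Ω : Set (EuclideanSpace ℝ (Fin n))} (hΩ : IsOpen Ω)
    {u v : EuclideanSpace ℝ (Fin n) → ℝ} (hu : IsWeight Ω u) (hv : IsWeight Ω v)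
    {r₁ r₂ s₁ s₂ : ℝ} (hr₁₂ : r₁ ≤ r₂) (hr₂ : r₂ < 0) (hs₁ : 0 < s₁) (hs₁₂ : s₁ ≤ s₂)
    {C₁ C₂ : ℝ} (hC₁ : 1 ≤ C₁) (hC₂ : 1 ≤ C₂)
    (hu' : MemRC Ω u ((r₁ : ℝ) : EReal) ((s₁ : ℝ) : EReal) C₁)
    (hv' : MemRC Ω v ((r₂ : ℝ) : EReal) ((s₂ : ℝ) : EReal) C₂)
    {θ : ℝ} (hθ₀ : 0 ≤ θ) (hθ₁ : θ ≤ 1)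
    {rθ sθ : ℝ} (hrθ : 1 / rθ = θ / r₁ + (1 - θ) / r₂)
    (hsθ : 1 / sθ = θ / s₁ + (1 - θ) / s₂) :
    rθ < 0 ∧ 0 < sθ ∧
    MemRC Ω (fun x => u x ^ θ * v x ^ (1 - θ)) ((rθ : ℝ) : EReal) ((sθ : ℝ) : EReal)
      (C₁ ^ θ * C₂ ^ (1 - θ)) := by
  have hr₁ : r₁ < 0 := hr₁₂.trans_lt hr₂
  have hs₂ : 0 < s₂ := hs₁.trans_le hs₁₂
  have hθ' : 0 ≤ 1 - θ := by linarith
  have hsp : 0 < sθ := by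
    rw [← one_div_pos, hsθ]
    rcases hθ₀.eq_or_lt with h | h
    · rw [← h]; simpa using hs₂
    · have := div_pos h hs₁
      have := div_nonneg hθ' hs₂.le
      linarith
  have hrn : rθ < 0 := by
    rw [← one_div_neg, hrθ]
    rcases hθ₀.eq_or_lt with h | h
    · rw [← h]; simpa using hr₂
    · have := div_neg_of_pos_of_neg h hr₁
      have := div_nonpos_of_nonneg_of_nonpos hθ' hr₂.le
      linarith
  refine ⟨hrn, hsp, ?_⟩
  intro B hB
  obtain ⟨hur, hus, huC⟩ := hu' B hB
  obtain ⟨hvr, hvs, hvC⟩ := hv' B hB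
  obtain ⟨x, ρ, hρ, rfl, hsub⟩ := hB
  have hsub' : Metric.ball x ρ ⊆ Ω := (Metric.ball_subset_ball (by linarith)).trans hsub
  have hpm : ∀ (w : EuclideanSpace ℝ (Fin n) → ℝ) (p : ℝ), p ≠ 0 →
      pMean w (p : EReal) (Metric.ball x ρ) =
        (⨍ y in Metric.ball x ρ, (w y) ^ p) ^ (1 / p) := by
    intro w p hp
    simp [pMean, hp]
  have hmf : ∀ (w : EuclideanSpace ℝ (Fin n) → ℝ) (p : ℝ), p ≠ 0 →
      (MeanFinite w (p : EReal) (Metric.ball x ρ) ↔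
        Integrable (fun y => (w y) ^ p) (volume.restrict (Metric.ball x ρ))) := by
    intro w p hp
    simp [MeanFinite, hp, IntegrableOn]
  set ν := volume.restrict (Metric.ball x ρ) with hν
  have hfin : IsFiniteMeasure ν := ⟨by
    rw [hν, Measure.restrict_apply_univ]; exact measure_ball_lt_top⟩
  have hne : NeZero ν := ⟨by
    rw [hν, Ne, Measure.restrict_eq_zero]; exact (Metric.measure_ball_pos _ _ hρ).ne'⟩
  have hii : ∀ f : EuclideanSpace ℝ (Fin n) → ℝ,
      Integrable f ((ν Set.univ)⁻¹ • ν) ↔ Integrable f ν := fun f =>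
    integrable_smul_measure (by simp) (by simp [hne.out])
  rw [hpm _ _ hr₁.ne, hpm _ _ hs₁.ne'] at huC
  rw [hpm _ _ hr₂.ne, hpm _ _ hs₂.ne'] at hvC
  rw [hmf _ _ hr₁.ne, ← hii] at hur
  rw [hmf _ _ hr₂.ne, ← hii] at hvr
  rw [hmf _ _ hs₁.ne', ← hii] at hus
  rw [hmf _ _ hs₂.ne', ← hii] at hvs
  rw [hpm _ _ hrn.ne, hpm _ _ hsp.ne', hmf _ _ hrn.ne, hmf _ _ hsp.ne', ← hii, ← hii]
  simp only [average] at huC hvC ⊢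
  set μ := (ν Set.univ)⁻¹ • ν with hμ
  have hprob : IsProbabilityMeasure μ := by rw [hμ]; infer_instance
  have hae : ∀ w, IsWeight Ω w → ∀ᵐ y ∂μ, 0 < w y := by
    intro w hw
    refine Measure.ae_smul_measure ?_ _
    rw [hν, ae_restrict_iff' measurableSet_ball]
    exact hw.2.mono fun y hy hyB => hy (hsub' hyB)
  obtain ⟨hA, hB, hI, hP, hL⟩ := rc_mean_aux (hae u hu) (hae v hv) hr₁.ne hr₂.ne hrn.ne hur hvr
    (div_nonneg_of_nonpos (mul_nonpos_of_nonneg_of_nonpos hθ₀ hrn.le) hr₁.le)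
    (div_nonneg_of_nonpos (mul_nonpos_of_nonneg_of_nonpos hθ' hrn.le) hr₂.le) hrθ
  obtain ⟨hA', hB', hI', hP', hL'⟩ := rc_mean_aux (hae u hu) (hae v hv) hs₁.ne' hs₂.ne' hsp.ne'
    hus hvs (by positivity) (by positivity) hsθ
  refine ⟨hI, hI', ?_⟩
  have hpow : ∀ (a b p q t : ℝ), 0 < a → 0 < b → t ≠ 0 →
      (a ^ (θ * t / p) * b ^ ((1 - θ) * t / q)) ^ (1 / t) =
        (a ^ (1 / p)) ^ θ * (b ^ (1 / q)) ^ (1 - θ) := by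
    intro a b p q t ha hb ht
    rw [Real.mul_rpow (by positivity) (by positivity), ← Real.rpow_mul ha.le, ← Real.rpow_mul ha.le,
      ← Real.rpow_mul hb.le, ← Real.rpow_mul hb.le]
    congr 2 <;> field_simp
  have h1 := Real.rpow_le_rpow hP'.le hL' (one_div_pos.2 hsp).le
  have h2 := Real.rpow_le_rpow_of_nonpos hP hL (one_div_neg.2 hrn).le
  rw [hpow _ _ _ _ _ hA' hB' hsp.ne'] at h1
  rw [hpow _ _ _ _ _ hA hB hrn.ne] at h2
  have hC₁' : 0 ≤ C₁ := by linarith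
  have hC₂' : 0 ≤ C₂ := by linarith
  refine h1.trans ?_
  refine (mul_le_mul (Real.rpow_le_rpow (by positivity) huC hθ₀)
    (Real.rpow_le_rpow (by positivity) hvC hθ') (by positivity) (by positivity)).trans ?_
  rw [Real.mul_rpow hC₁' (by positivity), Real.mul_rpow hC₂' (by positivity), mul_mul_mul_comm]
  exact mul_le_mul_of_nonneg_left h2 (by positivity)
end

section
/- (Corollary 7.2, interpolation of Muckenhoupt classes.) Let 1 ≤ p₁ < p₂ < ∞ and let w₁ ∈ A_{p₁} and w₂ ∈ A_{p₂} be weights. Then for every θ ∈ (0,1), the weight w₁^θ w₂^{1−θ} belongs to A_{p₃}, where p₃ := θ p₁ + (1−θ) p₂. -/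
open MeasureTheory

open Classical in
/-- The defining lower exponent of the Muckenhoupt class `A_p` (`p ≥ 1`):
`A_1 = RC(−∞,1)` and `A_p = RC(1/(1−p), 1)` for `p > 1`. -/
noncomputable def apExp (p : ℝ) : EReal :=
  if p = 1 then ⊥ else ((1 / (1 - p) : ℝ) : EReal)

/-- Weighted Hoelder inequality on a probability space, all in one. -/
lemma aux_holder {X : Type*} [MeasurableSpace X] (P : Measure X) [IsProbabilityMeasure P]
    (f g : X → ℝ) (hf : Integrable f P) (hg : Integrable g P)
    (hf0 : ∀ᵐ x ∂P, 0 < f x) (hg0 : ∀ᵐ x ∂P, 0 < g x) (s t : ℝ) (hs : 0 ≤ s) (ht : 0 ≤ t)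
    (hst : s + t = 1) :
    Integrable (fun x => f x ^ s * g x ^ t) P ∧
      ∫ x, f x ^ s * g x ^ t ∂P ≤ (∫ x, f x ∂P) ^ s * (∫ x, g x ∂P) ^ t := by
  have pos : ∀ h : X → ℝ, Integrable h P → (∀ᵐ x ∂P, 0 < h x) → 0 < ∫ x, h x ∂P := by
    intro h hi h0
    rw [integral_pos_iff_support_of_nonneg_ae (h0.mono fun x hx => hx.le) hi]
    have : P (Function.support h) = 1 := by
      rw [prob_compl_eq_zero_iff₀ hi.aestronglyMeasurable.nullMeasurableSet_support |>.symm]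
      rw [← mem_ae_iff]
      exact h0.mono fun x hx => hx.ne'
    rw [this]; exact one_pos
  have hF := pos f hf hf0
  have hG := pos g hg hg0
  set F := ∫ x, f x ∂P with hFd
  set G := ∫ x, g x ∂P with hGd
  have hb : ∀ᵐ x ∂P, f x ^ s * g x ^ t ≤ F ^ s * G ^ t * (s * (f x / F) + t * (g x / G)) := by
    filter_upwards [hf0, hg0] with x hx hy
    have h := Real.geom_mean_le_arith_mean2_weighted hs ht (div_pos hx hF).le (div_pos hy hG).le hst
    rw [Real.div_rpow hx.le hF.le, Real.div_rpow hy.le hG.le, div_mul_div_comm,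
      div_le_iff₀ (by positivity)] at h
    linarith
  have hi : Integrable (fun x => F ^ s * G ^ t * (s * (f x / F) + t * (g x / G))) P :=
    (((hf.div_const F).const_mul s).add ((hg.div_const G).const_mul t)).const_mul _
  have hI : Integrable (fun x => f x ^ s * g x ^ t) P := by
    refine hi.mono' ?_ ?_
    · exact ((hf.aemeasurable.pow_const s).mul (hg.aemeasurable.pow_const t)).aestronglyMeasurable
    · filter_upwards [hf0, hg0, hb] with x hx hy hz
      rwa [Real.norm_of_nonneg (by positivity)]
  refine ⟨hI, (integral_mono_ae hI hi hb).trans_eq ?_⟩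
  rw [integral_const_mul, integral_add ((hf.div_const F).const_mul s)
    ((hg.div_const G).const_mul t), integral_const_mul, integral_const_mul, integral_div,
    integral_div, ← hFd, ← hGd, div_self hF.ne', div_self hG.ne']
  simp [hst]

lemma aux_pos {X : Type*} [MeasurableSpace X] (P : Measure X) [IsProbabilityMeasure P]
    (h : X → ℝ) (hi : Integrable h P) (h0 : ∀ᵐ x ∂P, 0 < h x) : 0 < ∫ x, h x ∂P := by
  rw [integral_pos_iff_support_of_nonneg_ae (h0.mono fun x hx => hx.le) hi]
  have : P (Function.support h) = 1 := by
    rw [prob_compl_eq_zero_iff₀ hi.aestronglyMeasurable.nullMeasurableSet_support |>.symm]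
    rw [← mem_ae_iff]
    exact h0.mono fun x hx => hx.ne'
  rw [this]; exact one_pos

/-- Uniform reformulation of the `A_{1+a}` bound on one ball. -/
def AuxGood {X : Type*} [MeasurableSpace X] (P : Measure X) (w : X → ℝ) (a C : ℝ) : Prop :=
  Integrable w P ∧ ∃ (U : X → ℝ) (k : ℝ), 0 < k ∧ (∀ᵐ x ∂P, 0 < U x) ∧ Integrable U P ∧
    (∀ᵐ x ∂P, (w x)⁻¹ ≤ k * U x ^ a) ∧ k * (∫ x, U x ∂P) ^ a * ∫ x, w x ∂P ≤ C

lemma aux_interp {X : Type*} [MeasurableSpace X] (P : Measure X) [IsProbabilityMeasure P]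
    (w₁ w₂ : X → ℝ) (a b C₁ C₂ θ : ℝ) (ha : 0 ≤ a) (hb : 0 < b) (hθ₀ : 0 < θ) (hθ₁ : θ < 1)
    (h1 : ∀ᵐ x ∂P, 0 < w₁ x) (h2 : ∀ᵐ x ∂P, 0 < w₂ x)
    (H1 : AuxGood P w₁ a C₁) (H2 : AuxGood P w₂ b C₂) :
    AuxGood P (fun x => w₁ x ^ θ * w₂ x ^ (1 - θ)) (θ * a + (1 - θ) * b)
      (C₁ ^ θ * C₂ ^ (1 - θ)) := by
  obtain ⟨i1, U, k, hk, hU, iU, bU, cU⟩ := H1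
  obtain ⟨i2, V, l, hl, hV, iV, bV, cV⟩ := H2
  have hθ' : 0 < 1 - θ := by linarith
  set c := θ * a + (1 - θ) * b with hc
  have hc0 : 0 < c := by positivity
  have e1 := aux_holder P w₁ w₂ i1 i2 h1 h2 θ (1 - θ) hθ₀.le hθ'.le (by ring)
  have e2 := aux_holder P U V iU iV hU hV (θ * a / c) ((1 - θ) * b / c) (by positivity)
    (by positivity) (by rw [← add_div, ← hc, div_self hc0.ne'])
  have pU := aux_pos P U iU hU
  have pV := aux_pos P V iV hV
  have p1 := aux_pos P w₁ i1 h1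
  have p2 := aux_pos P w₂ i2 h2
  have key : ∀ u v : ℝ, 0 < u → 0 < v →
      (u ^ (θ * a / c) * v ^ ((1 - θ) * b / c)) ^ c = (u ^ a) ^ θ * (v ^ b) ^ (1 - θ) := by
    intro u v hu hv
    rw [Real.mul_rpow (by positivity) (by positivity), ← Real.rpow_mul hu.le,
      ← Real.rpow_mul hv.le, ← Real.rpow_mul hu.le, ← Real.rpow_mul hv.le,
      div_mul_cancel₀ _ hc0.ne', div_mul_cancel₀ _ hc0.ne', mul_comm a, mul_comm b]
  refine ⟨e1.1, fun x => U x ^ (θ * a / c) * V x ^ ((1 - θ) * b / c), k ^ θ * l ^ (1 - θ),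
    by positivity, ?_, e2.1, ?_, ?_⟩
  · filter_upwards [hU, hV] with x hx hy
    positivity
  · filter_upwards [hU, hV, bU, bV, h1, h2] with x hx hy hz hw q1 q2
    rw [key _ _ hx hy, mul_inv, ← Real.inv_rpow q1.le, ← Real.inv_rpow q2.le]
    calc _ ≤ (k * U x ^ a) ^ θ * (l * V x ^ b) ^ (1 - θ) := by gcongr
      _ = _ := by
        rw [Real.mul_rpow (by positivity) (by positivity),
          Real.mul_rpow (by positivity) (by positivity)]
        ring
  · have p3 : 0 ≤ ∫ x, U x ^ (θ * a / c) * V x ^ ((1 - θ) * b / c) ∂P :=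
      integral_nonneg_of_ae (by filter_upwards [hU, hV] with x hx hy; simp only [Pi.zero_apply]; positivity)
    have e3 := Real.rpow_le_rpow p3 e2.2 hc0.le
    rw [key _ _ pU pV] at e3
    have p4 : 0 ≤ (∫ x, U x ∂P) := pU.le
    calc _ ≤ k ^ θ * l ^ (1 - θ) *
          (((∫ x, U x ∂P) ^ a) ^ θ * ((∫ x, V x ∂P) ^ b) ^ (1 - θ)) *
          ((∫ x, w₁ x ∂P) ^ θ * (∫ x, w₂ x ∂P) ^ (1 - θ)) :=
          mul_le_mul (mul_le_mul_of_nonneg_left e3 (by positivity)) e1.2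
            (integral_nonneg_of_ae (by
              filter_upwards [h1, h2] with x hx hy; simp only [Pi.zero_apply]; positivity))
            (by positivity)
      _ = (k * (∫ x, U x ∂P) ^ a * ∫ x, w₁ x ∂P) ^ θ *
          (l * (∫ x, V x ∂P) ^ b * ∫ x, w₂ x ∂P) ^ (1 - θ) := by
        rw [Real.mul_rpow (by positivity) p1.le, Real.mul_rpow hk.le (by positivity),
          Real.mul_rpow (by positivity) p2.le, Real.mul_rpow hl.le (by positivity)]
        ring
      _ ≤ _ := by
        have : 0 ≤ C₁ := le_trans (by positivity) cU
        gcongr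

lemma aux_final {X : Type*} [MeasurableSpace X] (P : Measure X) [IsProbabilityMeasure P]
    (w : X → ℝ) (c C : ℝ) (hc : 0 < c) (hC : 0 ≤ C) (h : ∀ᵐ x ∂P, 0 < w x)
    (H : AuxGood P w c C) :
    Integrable (fun x => w x ^ (-c⁻¹)) P ∧ ∫ x, w x ∂P ≤ C * (∫ x, w x ^ (-c⁻¹) ∂P) ^ (-c) := by
  obtain ⟨i1, U, k, hk, hU, iU, bU, cU⟩ := H
  have hb : ∀ᵐ x ∂P, w x ^ (-c⁻¹) ≤ k ^ c⁻¹ * U x := by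
    filter_upwards [hU, bU, h] with x hx hy hz
    rw [Real.rpow_neg hz.le, ← Real.inv_rpow hz.le]
    calc _ ≤ (k * U x ^ c) ^ c⁻¹ := by gcongr
      _ = _ := by rw [Real.mul_rpow hk.le (by positivity), Real.rpow_rpow_inv hx.le hc.ne']
  have hI : Integrable (fun x => w x ^ (-c⁻¹)) P := by
    refine (iU.const_mul (k ^ c⁻¹)).mono' (i1.aemeasurable.pow_const _).aestronglyMeasurable ?_
    filter_upwards [h, hb] with x hx hy
    rwa [Real.norm_of_nonneg (by positivity)]
  refine ⟨hI, ?_⟩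
  have pos : 0 < ∫ x, w x ^ (-c⁻¹) ∂P :=
    aux_pos P _ hI (h.mono fun x hx => by positivity)
  have pU := aux_pos P U iU hU
  have p1 := aux_pos P w i1 h
  have e := integral_mono_ae hI (iU.const_mul (k ^ c⁻¹)) hb
  rw [integral_const_mul] at e
  have e2 := Real.rpow_le_rpow pos.le e hc.le
  rw [Real.mul_rpow (by positivity) pU.le, Real.rpow_inv_rpow hk.le hc.ne'] at e2
  rw [Real.rpow_neg pos.le, ← div_eq_mul_inv, le_div_iff₀ (by positivity), mul_comm]
  exact (mul_le_mul_of_nonneg_right e2 p1.le).trans cU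

/-- Normalized restriction. -/
noncomputable def auxP {n : ℕ} (B : Set (EuclideanSpace ℝ (Fin n))) :
    Measure (EuclideanSpace ℝ (Fin n)) :=
  ((volume.restrict B) Set.univ)⁻¹ • volume.restrict B

lemma aux_avg {n : ℕ} (B : Set (EuclideanSpace ℝ (Fin n)))
    (f : EuclideanSpace ℝ (Fin n) → ℝ) : ⨍ x in B, f x = ∫ x, f x ∂(auxP B) := rfl

lemma aux_ball {n : ℕ} {Ω B : Set (EuclideanSpace ℝ (Fin n))} (hB : B ∈ ballsIn Ω) :
    MeasurableSet B ∧ volume B ≠ 0 ∧ volume B ≠ ⊤ ∧ B ⊆ Ω := by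
  obtain ⟨x, ρ, hρ, rfl, h⟩ := hB
  exact ⟨measurableSet_ball, (Metric.measure_ball_pos _ _ hρ).ne', measure_ball_lt_top.ne,
    (Metric.ball_subset_ball (by linarith)).trans h⟩

lemma aux_int {n : ℕ} {B : Set (EuclideanSpace ℝ (Fin n))} (h0 : volume B ≠ 0)
    (h1 : volume B ≠ ⊤) (f : EuclideanSpace ℝ (Fin n) → ℝ) :
    Integrable f (auxP B) ↔ IntegrableOn f B := by
  unfold auxP
  rw [integrable_smul_measure]
  · rfl
  · simpa using h1
  · simpa using h0

lemma aux_ae {n : ℕ} {B : Set (EuclideanSpace ℝ (Fin n))}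
    (h1 : volume B ≠ ⊤) (p : EuclideanSpace ℝ (Fin n) → Prop) :
    (∀ᵐ x ∂(auxP B), p x) ↔ ∀ᵐ x ∂(volume.restrict B), p x := by
  unfold auxP
  rw [Measure.ae_ennreal_smul_measure_iff]
  simpa using h1

lemma aux_apExp {p : ℝ} (hp : 1 < p) : apExp p = ((-(p - 1)⁻¹ : ℝ) : EReal) := by
  unfold apExp
  rw [if_neg hp.ne', one_div, ← inv_neg, neg_sub]

lemma aux_coe {n : ℕ} (w : EuclideanSpace ℝ (Fin n) → ℝ) (r : ℝ) (hr : r ≠ 0)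
    (B : Set (EuclideanSpace ℝ (Fin n))) :
    (MeanFinite w (r : EReal) B ↔ IntegrableOn (fun x => w x ^ r) B) ∧
    pMean w (r : EReal) B = (∫ x, w x ^ r ∂(auxP B)) ^ (1 / r) := by
  unfold MeanFinite pMean
  simp [hr, aux_avg]

lemma aux_one {n : ℕ} (w : EuclideanSpace ℝ (Fin n) → ℝ)
    (B : Set (EuclideanSpace ℝ (Fin n))) :
    (MeanFinite w 1 B ↔ IntegrableOn w B) ∧ pMean w 1 B = ∫ x, w x ∂(auxP B) := by
  have := aux_coe w 1 one_ne_zero B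
  simpa using this

lemma aux_good {n : ℕ} {Ω B : Set (EuclideanSpace ℝ (Fin n))} (hB : B ∈ ballsIn Ω)
    [IsProbabilityMeasure (auxP B)]
    (w : EuclideanSpace ℝ (Fin n) → ℝ) (h : ∀ᵐ x ∂(auxP B), 0 < w x) (p C : ℝ) (hp : 1 ≤ p)
    (hC : 1 ≤ C) (H : MemRC Ω w (apExp p) 1 C) : AuxGood (auxP B) w (p - 1) C := by
  obtain ⟨hm, h0, ht, -⟩ := aux_ball hB
  obtain ⟨f1, f2, f3⟩ := H B hB
  rw [(aux_one w B).1, ← aux_int h0 ht] at f2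
  rw [(aux_one w B).2] at f3
  have p1 := aux_pos _ w f2 h
  refine ⟨f2, ?_⟩
  rcases hp.eq_or_lt with rfl | hp
  · have e : apExp 1 = ⊥ := by simp [apExp]
    rw [e] at f1 f3
    simp only [pMean, MeanFinite, bot_ne_top, if_true, if_false] at f1 f3
    obtain ⟨m, hm⟩ := f1
    have hne : volume.restrict B ≠ 0 := by simpa using h0
    have : (ae (volume.restrict B)).NeBot := ae_neBot.2 hne
    have hE : ∀ᵐ x ∂(volume.restrict B), essInf w (volume.restrict B) ≤ w x := by
      refine ae_essInf_le ?_
      exact ⟨m, hm⟩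
    rw [← aux_ae ht] at hE
    refine ⟨fun _ => 1, C / ∫ x, w x ∂(auxP B), by positivity, by simp, integrable_const _, ?_, ?_⟩
    · filter_upwards [hE, h] with x hx hy
      simp only [sub_self, Real.rpow_zero, mul_one]
      rw [inv_le_comm₀ hy (by positivity), inv_div, div_le_iff₀ (by positivity)]
      nlinarith
    · simp [div_mul_cancel₀ _ p1.ne']
  · have hr : -(p - 1)⁻¹ ≠ 0 := by
      have : 0 < p - 1 := by linarith
      simp [this.ne']
    have hp' : 0 < p - 1 := by linarith
    rw [aux_apExp hp, (aux_coe w _ hr B).1, ← aux_int h0 ht] at f1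
    rw [aux_apExp hp, (aux_coe w _ hr B).2] at f3
    have hpos : ∀ᵐ x ∂(auxP B), 0 < w x ^ (-(p - 1)⁻¹) := h.mono fun x hx => by positivity
    have pU := aux_pos _ _ f1 hpos
    refine ⟨_, 1, one_pos, hpos, f1, ?_, ?_⟩
    · filter_upwards [h] with x hx
      rw [one_mul, ← Real.rpow_mul hx.le, neg_mul, inv_mul_cancel₀ hp'.ne', Real.rpow_neg_one]
    · have : 1 / -(p - 1)⁻¹ = -(p - 1) := by rw [one_div, inv_neg, inv_inv]
      rw [this, Real.rpow_neg pU.le, ← div_eq_mul_inv, le_div_iff₀ (by positivity)] at f3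
      linarith

/-- **Corollary 7.2 (interpolation of Muckenhoupt classes).** Let `1 ≤ p₁ < p₂ < ∞`,
`w₁ ∈ A_{p₁}`, `w₂ ∈ A_{p₂}`. Then for every `θ ∈ (0,1)` the weight `w₁^θ w₂^{1−θ}` belongs
to `A_{p₃}` with `p₃ = θp₁ + (1−θ)p₂`. -/
theorem ap_interpolation {n : ℕ} (hn : 1 ≤ n)
    {Ω : Set (EuclideanSpace ℝ (Fin n))} (hΩ : IsOpen Ω)
    {w₁ w₂ : EuclideanSpace ℝ (Fin n) → ℝ} (hw₁ : IsWeight Ω w₁) (hw₂ : IsWeight Ω w₂)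
    {p₁ p₂ : ℝ} (hp₁ : 1 ≤ p₁) (hp₁₂ : p₁ < p₂)
    (h₁ : InRC Ω w₁ (apExp p₁) 1) (h₂ : InRC Ω w₂ (apExp p₂) 1)
    {θ : ℝ} (hθ₀ : 0 < θ) (hθ₁ : θ < 1) :
    InRC Ω (fun x => w₁ x ^ θ * w₂ x ^ (1 - θ)) (apExp (θ * p₁ + (1 - θ) * p₂)) 1 := by
  obtain ⟨C₁, hC₁, H₁⟩ := h₁
  obtain ⟨C₂, hC₂, H₂⟩ := h₂
  have hθ' : 0 < 1 - θ := by linarith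
  have hp₃ : 1 < θ * p₁ + (1 - θ) * p₂ := by nlinarith
  have hC : 1 ≤ C₁ ^ θ * C₂ ^ (1 - θ) :=
    one_le_mul_of_one_le_of_one_le (Real.one_le_rpow hC₁ hθ₀.le) (Real.one_le_rpow hC₂ hθ'.le)
  refine ⟨C₁ ^ θ * C₂ ^ (1 - θ), hC, ?_⟩
  intro B hB
  obtain ⟨hm, h0, ht, hs⟩ := aux_ball hB
  haveI : IsProbabilityMeasure (auxP B) := by
    refine ⟨?_⟩
    simp [auxP, ENNReal.inv_mul_cancel h0 ht]
  have pos : ∀ w, IsWeight Ω w → ∀ᵐ x ∂(auxP B), 0 < w x := by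
    intro w hw
    rw [aux_ae ht, ae_restrict_iff' hm]
    exact hw.2.mono fun x hx hxB => hx (hs hxB)
  have q1 := pos _ hw₁
  have q2 := pos _ hw₂
  have G := aux_interp (auxP B) w₁ w₂ (p₁ - 1) (p₂ - 1) C₁ C₂ θ (by linarith) (by linarith)
    hθ₀ hθ₁ q1 q2 (aux_good hB w₁ q1 p₁ C₁ hp₁ hC₁ H₁)
    (aux_good hB w₂ q2 p₂ C₂ (by linarith) hC₂ H₂)
  have ec : θ * (p₁ - 1) + (1 - θ) * (p₂ - 1) = θ * p₁ + (1 - θ) * p₂ - 1 := by ring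
  rw [ec] at G
  set p₃ := θ * p₁ + (1 - θ) * p₂ with hp₃d
  have hc : 0 < p₃ - 1 := by linarith
  have q3 : ∀ᵐ x ∂(auxP B), 0 < w₁ x ^ θ * w₂ x ^ (1 - θ) := by
    filter_upwards [q1, q2] with x hx hy
    positivity
  have F := aux_final (auxP B) _ _ _ hc (by linarith) q3 G
  have hr : -(p₃ - 1)⁻¹ ≠ 0 := by simp [hc.ne']
  have hinv : 1 / -(p₃ - 1)⁻¹ = -(p₃ - 1) := by rw [one_div, inv_neg, inv_inv]
  rw [aux_apExp hp₃, (aux_coe _ _ hr B).1, (aux_coe _ _ hr B).2, (aux_one _ B).1, (aux_one _ B).2,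
    ← aux_int h0 ht, ← aux_int h0 ht, hinv]
  exact ⟨F.1, G.1, F.2⟩
end
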